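/- arXiv:1802.07581 — 2 statements merged into one kernel-verified Lean document; each statement's English description precedes it below -/
import Mathlib

section
/- Let k : X × X → ℝ be a bounded measurable symmetric positive semidefinite kernel on a Polish space X with 0 ≤ k(·,·) ≤ K. Let y_1, …, y_m be i.i.d. with law P, and let P̂_m = (1/m)∑_{i=1}^m δ_{y_i} be the empirical measure. Then for every ε > 0, Prob( d_k(P, P̂_m) > sqrt(2K/m) + ε ) ≤ exp( −ε² m / (2K) ). -/
open MeasureTheory Filter Topology ENNReal
open scoped Classical

noncomputable section
/-- The empirical measure `(1/n) ∑_{i<n} δ_{x i}` of a sample, as a probability measure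
(junk value for `n = 0`). -/
def empMeas {X : Type*} [MeasurableSpace X] [Nonempty X] (n : ℕ) (x : Fin n → X) :
    ProbabilityMeasure X :=
  if h : 0 < n then
    ⟨(n : ℝ≥0∞)⁻¹ • ∑ i, Measure.dirac (x i), by
      constructor
      simp only [Measure.smul_apply, smul_eq_mul, Measure.coe_finset_sum, Finset.sum_apply,
        measure_univ, Finset.sum_const, Finset.card_univ, Fintype.card_fin, nsmul_eq_mul, mul_one]
      exact ENNReal.inv_mul_cancel (by exact_mod_cast h.ne') (by simp)⟩
  else ⟨Measure.dirac (Classical.arbitrary X), inferInstance⟩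
/-- The squared Maximum Mean Discrepancy associated with the kernel `k`. -/
def mmdSq {X : Type*} [MeasurableSpace X] (k : X → X → ℝ) (P Q : Measure X) : ℝ :=
  (∫ y, ∫ y', k y y' ∂P ∂P) + (∫ x, ∫ x', k x x' ∂Q ∂Q) - 2 * ∫ y, ∫ x, k y x ∂Q ∂P

/-- The Maximum Mean Discrepancy `d_k`, the nonnegative square root of `mmdSq`. -/
def mmd {X : Type*} [MeasurableSpace X] (k : X → X → ℝ) (P Q : Measure X) : ℝ :=
  Real.sqrt (mmdSq k P Q)

open ProbabilityTheory

/-- **Hoeffding's lemma** for a function of bounded oscillation. -/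
lemma integral_exp_mul_le_of_sub_le {Ω : Type*} [MeasurableSpace Ω] {μ : Measure Ω}
    [IsProbabilityMeasure μ] {g : Ω → ℝ} (hg : Measurable g) {c : ℝ}
    (hgc : ∀ x x', g x' - g x ≤ c) (t : ℝ) :
    ∫ x, Real.exp (t * g x) ∂μ ≤ Real.exp (t * ∫ x, g x ∂μ + c ^ 2 * t ^ 2 / 8) := by
  obtain ⟨x₀⟩ := nonempty_of_isProbabilityMeasure μ
  have hbdd : BddAbove (Set.range g) := ⟨g x₀ + c, by
    rintro _ ⟨x, rfl⟩; linarith [hgc x₀ x]⟩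
  have : Nonempty Ω := ⟨x₀⟩
  have hmem : ∀ x, g x ∈ Set.Icc ((⨆ x, g x) - c) (⨆ x, g x) := fun x ↦
    ⟨by linarith [ciSup_le fun x' ↦ show g x' ≤ g x + c by linarith [hgc x x']],
      le_ciSup hbdd x⟩
  have h := (hasSubgaussianMGF_of_mem_Icc (μ := μ) hg.aemeasurable (ae_of_all _ hmem)).mgf_le t
  have hexp : ∀ x, Real.exp (t * (g x - ∫ x, g x ∂μ))
      = Real.exp (t * g x) * Real.exp (-(t * ∫ x, g x ∂μ)) := fun x ↦ by
    rw [← Real.exp_add]; ring_nf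
  simp only [mgf, hexp, integral_mul_const] at h
  rw [Real.exp_neg, ← div_eq_mul_inv, div_le_iff₀ (Real.exp_pos _), ← Real.exp_add] at h
  refine h.trans (Real.exp_le_exp.2 (le_of_eq ?_))
  simp only [NNReal.coe_pow, NNReal.coe_div, coe_nnnorm, Real.norm_eq_abs,
    NNReal.coe_ofNat, div_pow, sq_abs]
  ring

section BoundedDifferences

variable {X : Type*} [MeasurableSpace X] {P : Measure X} [IsProbabilityMeasure P]

lemma integrable_of_measurable_of_abs_le {Ω : Type*} [MeasurableSpace Ω] {μ : Measure Ω}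
    [IsFiniteMeasure μ] {f : Ω → ℝ} (hf : Measurable f) {M : ℝ} (hM : ∀ x, |f x| ≤ M) :
    Integrable f μ :=
  Integrable.of_bound hf.aestronglyMeasurable M (ae_of_all _ hM)

lemma integrable_exp_mul_of_abs_le {Ω : Type*} [MeasurableSpace Ω] {μ : Measure Ω}
    [IsFiniteMeasure μ] {f : Ω → ℝ} (hf : Measurable f) {M : ℝ} (hM : ∀ x, |f x| ≤ M) (t : ℝ) :
    Integrable (fun x ↦ Real.exp (t * f x)) μ :=
  integrable_exp_mul_of_mem_Icc hf.aemeasurable (ae_of_all _ fun x ↦ abs_le.1 (hM x))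

lemma measurable_finCons (n : ℕ) :
    Measurable fun p : X × (Fin n → X) ↦ (Fin.cons p.1 p.2 : Fin (n + 1) → X) := by
  refine measurable_pi_lambda _ fun i ↦ ?_
  cases i using Fin.cases with
  | zero => simpa using measurable_fst
  | succ i =>
    simp only [Fin.cons_succ]
    fun_prop

lemma integral_pi_finSucc {n : ℕ} {f : (Fin (n + 1) → X) → ℝ}
    (hf : Integrable f (Measure.pi fun _ : Fin (n + 1) ↦ P)) :
    ∫ y, f y ∂Measure.pi (fun _ : Fin (n + 1) ↦ P)
      = ∫ x, ∫ y, f (Fin.cons x y) ∂Measure.pi (fun _ : Fin n ↦ P) ∂P := by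
  have h := (measurePreserving_piFinSuccAbove (fun _ : Fin (n + 1) ↦ P) 0).symm
  have hcons : ∀ p : X × (Fin n → X),
      (MeasurableEquiv.piFinSuccAbove (fun _ : Fin (n + 1) ↦ X) 0).symm p
        = Fin.cons p.1 p.2 := fun p ↦ by
    simp [MeasurableEquiv.piFinSuccAbove_symm_apply, Fin.insertNthEquiv]
  rw [← h.integral_comp']
  have hi := (h.integrable_comp_emb (MeasurableEquiv.measurableEmbedding _)).2 hf
  have hi' : Integrable (fun p : X × (Fin n → X) ↦ f (Fin.cons p.1 p.2))
      (P.prod (Measure.pi fun _ : Fin n ↦ P)) := hi.congr (ae_of_all _ fun p ↦ by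
    simp only [Function.comp_apply, hcons])
  simp_rw [hcons]
  exact integral_prod _ hi'

lemma integral_exp_mul_le_of_boundedDifferences {n : ℕ} {f : (Fin n → X) → ℝ}
    (hf : Measurable f) {M : ℝ} (hM : ∀ y, |f y| ≤ M) {c : ℝ}
    (hc : ∀ y i b, f (Function.update y i b) - f y ≤ c) (t : ℝ) :
    ∫ y, Real.exp (t * f y) ∂Measure.pi (fun _ : Fin n ↦ P)
      ≤ Real.exp (t * ∫ y, f y ∂Measure.pi (fun _ : Fin n ↦ P) + n * c ^ 2 * t ^ 2 / 8) := by
  induction n with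
  | zero =>
    have hconst : ∀ y : Fin 0 → X, f y = f Fin.elim0 :=
      fun y ↦ congrArg f (Subsingleton.elim _ _)
    simp [hconst]
  | succ n ih =>
    have hfx : ∀ x, Measurable fun y : Fin n → X ↦ f (Fin.cons x y) := fun x ↦
      hf.comp ((measurable_finCons n).comp measurable_prodMk_left)
    have hint : ∀ x, Integrable (fun y : Fin n → X ↦ f (Fin.cons x y))
        (Measure.pi fun _ : Fin n ↦ P) :=
      fun x ↦ integrable_of_measurable_of_abs_le (hfx x) fun y ↦ hM _
    set g : X → ℝ := fun x ↦ ∫ y, f (Fin.cons x y) ∂Measure.pi (fun _ : Fin n ↦ P)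
    have hg : Measurable g :=
      ((hf.comp (measurable_finCons n)).stronglyMeasurable.integral_prod_right').measurable
    have hgM : ∀ x, |g x| ≤ M := fun x ↦ by
      simpa using norm_integral_le_of_norm_le_const (μ := Measure.pi fun _ : Fin n ↦ P)
        (C := M) (f := fun y ↦ f (Fin.cons x y)) (ae_of_all _ fun y ↦ hM (Fin.cons x y))
    have hgc : ∀ x x', g x' - g x ≤ c := fun x x' ↦ by
      rw [← integral_sub (hint x') (hint x)]
      refine (integral_mono ((hint x').sub (hint x)) (integrable_const c) fun y ↦ ?_).trans
        (by simp)
      simpa [Fin.update_cons_zero] using hc (Fin.cons x y) 0 x'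
    rw [integral_pi_finSucc (integrable_exp_mul_of_abs_le hf hM t),
      integral_pi_finSucc (integrable_of_measurable_of_abs_le hf hM)]
    calc ∫ x, ∫ y, Real.exp (t * f (Fin.cons x y)) ∂Measure.pi (fun _ : Fin n ↦ P) ∂P
        ≤ ∫ x, Real.exp (t * g x) * Real.exp (n * c ^ 2 * t ^ 2 / 8) ∂P := by
          refine integral_mono_of_nonneg (ae_of_all _ fun x ↦ integral_nonneg fun y ↦
            (Real.exp_pos _).le) ((integrable_exp_mul_of_abs_le hg hgM t).mul_const _)
            (ae_of_all _ fun x ↦ ?_)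
          simp only [← Real.exp_add]
          exact ih (hfx x) (fun y ↦ hM _) fun y i b ↦ by
            rw [Fin.cons_update]; exact hc _ _ _
      _ ≤ Real.exp (t * ∫ x, g x ∂P + c ^ 2 * t ^ 2 / 8) * Real.exp (n * c ^ 2 * t ^ 2 / 8) := by
          rw [integral_mul_const]
          gcongr
          exact integral_exp_mul_le_of_sub_le hg hgc t
      _ = _ := by
          rw [← Real.exp_add]
          push_cast
          congr 1
          ring

/-- **McDiarmid's inequality** for i.i.d. samples: a bounded measurable function which changes by
at most `c` when one coordinate is modified concentrates around its mean. -/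
lemma measure_pi_ge_le_of_boundedDifferences {n : ℕ} {f : (Fin n → X) → ℝ}
    (hf : Measurable f) {M : ℝ} (hM : ∀ y, |f y| ≤ M) {c : ℝ}
    (hc : ∀ y i b, f (Function.update y i b) - f y ≤ c) {ε : ℝ} (hε : 0 ≤ ε) :
    (Measure.pi fun _ : Fin n ↦ P).real
        {y | ε ≤ f y - ∫ y, f y ∂Measure.pi (fun _ : Fin n ↦ P)}
      ≤ Real.exp (-2 * ε ^ 2 / (n * c ^ 2)) := by
  set E := ∫ y, f y ∂Measure.pi (fun _ : Fin n ↦ P) with hE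
  have hexp : ∀ t y, Real.exp (t * (f y - E)) = Real.exp (t * f y) * Real.exp (-(t * E)) :=
    fun t y ↦ by rw [← Real.exp_add]; ring_nf
  have hsub : HasSubgaussianMGF (fun y ↦ f y - E) (n * (‖c‖₊ / 2) ^ 2)
      (Measure.pi fun _ : Fin n ↦ P) := by
    refine ⟨fun t ↦ ?_, fun t ↦ ?_⟩
    · simp only [hexp]
      exact (integrable_exp_mul_of_abs_le hf hM t).mul_const _
    · simp only [mgf, hexp, integral_mul_const]
      rw [Real.exp_neg, ← div_eq_mul_inv, div_le_iff₀ (Real.exp_pos _), ← Real.exp_add]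
      refine (integral_exp_mul_le_of_boundedDifferences hf hM hc t).trans
        (Real.exp_le_exp.2 (le_of_eq ?_))
      simp only [NNReal.coe_mul, NNReal.coe_natCast, NNReal.coe_pow, NNReal.coe_div, coe_nnnorm,
        Real.norm_eq_abs, NNReal.coe_ofNat, div_pow, sq_abs, ← hE]
      ring
  refine (hsub.measure_ge_le hε).trans (Real.exp_le_exp.2 (le_of_eq ?_))
  simp only [NNReal.coe_mul, NNReal.coe_natCast, NNReal.coe_pow, NNReal.coe_div, coe_nnnorm,
    Real.norm_eq_abs, NNReal.coe_ofNat, div_pow, sq_abs]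
  rw [show (2 : ℝ) * (n * (c ^ 2 / 2 ^ 2)) = (n * c ^ 2) / 2 by ring, div_div_eq_mul_div]
  ring

end BoundedDifferences

section KernelForm

variable {X : Type*} [MeasurableSpace X] {P : Measure X} [IsProbabilityMeasure P]
  {k : X → X → ℝ} {K : ℝ}

lemma posSemidef_kernel_fintype {X : Type*} {k : X → X → ℝ}
    (hk_psd : ∀ (N : ℕ) (z : Fin N → X) (c : Fin N → ℝ),
      0 ≤ ∑ i, ∑ j, c i * c j * k (z i) (z j))
    {ι : Type*} [Fintype ι] (z : ι → X) (c : ι → ℝ) :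
    0 ≤ ∑ i, ∑ j, c i * c j * k (z i) (z j) := by
  let e := (Fintype.equivFin ι).symm
  have h := hk_psd _ (z ∘ e) (c ∘ e)
  rw [← e.sum_comp]
  simp_rw [← e.sum_comp (fun j ↦ c _ * c j * k (z _) (z j))]
  exact h

lemma integral_pi_eval_pair (hk_meas : Measurable fun p : X × X ↦ k p.1 p.2)
    (hk_bdd : ∀ x y, k x y ∈ Set.Icc (0 : ℝ) K) {n : ℕ} {i j : Fin n} (hij : i ≠ j) :
    ∫ y, k (y i) (y j) ∂Measure.pi (fun _ : Fin n ↦ P) = ∫ x, ∫ x', k x x' ∂P ∂P := by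
  have hind := (iIndepFun_pi (μ := fun _ : Fin n ↦ P) (X := fun _ x ↦ x)
    fun _ ↦ aemeasurable_id).indepFun hij
  rw [indepFun_iff_map_prod_eq_prod_map_map (measurable_pi_apply i).aemeasurable
    (measurable_pi_apply j).aemeasurable] at hind
  have heval : ∀ i : Fin n, (Measure.pi fun _ : Fin n ↦ P).map (fun y ↦ y i) = P := fun i ↦
    (measurePreserving_eval (fun _ : Fin n ↦ P) i).map_eq
  rw [heval i, heval j] at hind
  have hint : Integrable (fun p : X × X ↦ k p.1 p.2) (P.prod P) :=
    Integrable.of_mem_Icc 0 K hk_meas.aemeasurable (ae_of_all _ fun p ↦ hk_bdd _ _)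
  rw [← integral_prod (fun p : X × X ↦ k p.1 p.2) hint, ← hind, integral_map]
  · exact ((measurable_pi_apply i).prodMk (measurable_pi_apply j)).aemeasurable
  · exact hk_meas.aestronglyMeasurable

lemma integral_pi_eval {n : ℕ} (i : Fin n) {g : X → ℝ} (hg : Measurable g) :
    ∫ y, g (y i) ∂Measure.pi (fun _ : Fin n ↦ P) = ∫ x, g x ∂P := by
  have hi := (measurePreserving_eval (fun _ : Fin n ↦ P) i).map_eq
  conv_rhs => rw [← hi]
  rw [integral_map (measurable_pi_apply i).aemeasurable hg.aestronglyMeasurable]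

lemma measurable_kernel_eval (hk_meas : Measurable fun p : X × X ↦ k p.1 p.2) {n : ℕ}
    (i j : Fin n) : Measurable fun y : Fin n → X ↦ k (y i) (y j) :=
  hk_meas.comp (f := fun y : Fin n → X ↦ (y i, y j)) (by fun_prop)

lemma integrable_kernel_eval (hk_meas : Measurable fun p : X × X ↦ k p.1 p.2)
    (hk_bdd : ∀ x y, k x y ∈ Set.Icc (0 : ℝ) K) {n : ℕ} (i j : Fin n) :
    Integrable (fun y : Fin n → X ↦ k (y i) (y j)) (Measure.pi fun _ : Fin n ↦ P) :=
  Integrable.of_mem_Icc 0 K (measurable_kernel_eval hk_meas i j).aemeasurable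
    (ae_of_all _ fun _ ↦ hk_bdd _ _)

lemma integral_pi_sum_sum_kernel (hk_meas : Measurable fun p : X × X ↦ k p.1 p.2)
    (hk_bdd : ∀ x y, k x y ∈ Set.Icc (0 : ℝ) K) (n : ℕ) :
    ∫ y, ∑ i, ∑ j, k (y i) (y j) ∂Measure.pi (fun _ : Fin n ↦ P)
      = n * ∫ x, k x x ∂P + n * (n - 1) * ∫ x, ∫ x', k x x' ∂P ∂P := by
  rw [integral_finsetSum _ fun i _ ↦ integrable_finsetSum _ fun j _ ↦
    integrable_kernel_eval hk_meas hk_bdd i j]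
  simp_rw [integral_finsetSum _ fun j _ ↦ integrable_kernel_eval hk_meas hk_bdd _ j]
  have hrow : ∀ i : Fin n, ∑ j, ∫ y, k (y i) (y j) ∂Measure.pi (fun _ : Fin n ↦ P)
      = ∫ x, k x x ∂P + (n - 1) * ∫ x, ∫ x', k x x' ∂P ∂P := fun i ↦ by
    have hn : 1 ≤ n := i.pos
    rw [← Finset.add_sum_erase _ _ (Finset.mem_univ i),
      integral_pi_eval i (g := fun x ↦ k x x) (hk_meas.comp (measurable_id.prodMk measurable_id)),
      Finset.sum_congr rfl fun j hj ↦
        integral_pi_eval_pair hk_meas hk_bdd (Finset.ne_of_mem_erase hj).symm]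
    simp [Finset.card_erase_of_mem, Nat.cast_sub hn]
  simp only [hrow, Finset.sum_const, Finset.card_univ, Fintype.card_fin, nsmul_eq_mul]
  ring

lemma integral_diag_mem_Icc (hk_meas : Measurable fun p : X × X ↦ k p.1 p.2)
    (hk_bdd : ∀ x y, k x y ∈ Set.Icc (0 : ℝ) K) :
    ∫ x, k x x ∂P ∈ Set.Icc 0 K := by
  refine ⟨integral_nonneg fun x ↦ (hk_bdd x x).1, ?_⟩
  have hint : Integrable (fun x ↦ k x x) P :=
    Integrable.of_mem_Icc 0 K (hk_meas.comp (measurable_id.prodMk measurable_id)).aemeasurable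
      (ae_of_all _ fun x ↦ hk_bdd x x)
  exact (integral_mono hint (integrable_const K) fun x ↦ (hk_bdd x x).2).trans (by simp)

/-- Positive semidefiniteness of the kernel extends from finitely supported signed measures to
measures of the form `P - ∑ i, c i • δ (z i)`. -/
lemma integral_kernel_sub_sum_nonneg (hk_meas : Measurable fun p : X × X ↦ k p.1 p.2)
    (hk_symm : ∀ x y, k x y = k y x)
    (hk_psd : ∀ (N : ℕ) (z : Fin N → X) (c : Fin N → ℝ),
      0 ≤ ∑ i, ∑ j, c i * c j * k (z i) (z j))
    (hk_bdd : ∀ x y, k x y ∈ Set.Icc (0 : ℝ) K)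
    {ι : Type*} [Fintype ι] (z : ι → X) (c : ι → ℝ) :
    0 ≤ ∫ x, ∫ x', k x x' ∂P ∂P - 2 * ∑ i, c i * ∫ x, k (z i) x ∂P
      + ∑ i, ∑ j, c i * c j * k (z i) (z j) := by
  set κ := ∫ x, ∫ x', k x x' ∂P ∂P with hκ
  set L := ∑ i, c i * ∫ x, k (z i) x ∂P with hL
  set S := ∑ i, ∑ j, c i * c j * k (z i) (z j) with hS
  set D := ∫ x, k x x ∂P with hD
  have hsec : ∀ i, Measurable (k (z i)) := fun i ↦ hk_meas.comp measurable_prodMk_left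
  have key : ∀ n : ℕ, 0 < n → 0 ≤ κ - 2 * L + S + (D - κ) * (n : ℝ)⁻¹ := fun n hn ↦ by
    have hn' : (n : ℝ) ≠ 0 := by positivity
    have hpt : ∀ y : Fin n → X, 0 ≤ (n : ℝ)⁻¹ ^ 2 * (∑ a, ∑ b, k (y a) (y b))
        - 2 * (n : ℝ)⁻¹ * (∑ i, c i * ∑ a, k (z i) (y a)) + S := fun y ↦ by
      have h := posSemidef_kernel_fintype hk_psd (Sum.elim y z)
        (Sum.elim (fun _ ↦ (n : ℝ)⁻¹) fun i ↦ - c i)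
      simp only [Fintype.sum_sum_type, Sum.elim_inl, Sum.elim_inr, Finset.sum_add_distrib] at h
      have h1 : ∑ a, ∑ b, (n : ℝ)⁻¹ * (n : ℝ)⁻¹ * k (y a) (y b)
          = (n : ℝ)⁻¹ ^ 2 * ∑ a, ∑ b, k (y a) (y b) := by
        simp_rw [← Finset.mul_sum]; ring
      have h2 : ∑ a, ∑ i, (n : ℝ)⁻¹ * - c i * k (y a) (z i)
          = - ((n : ℝ)⁻¹ * ∑ i, c i * ∑ a, k (z i) (y a)) := by
        rw [Finset.sum_comm]
        simp_rw [Finset.mul_sum, ← Finset.sum_neg_distrib]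
        refine Finset.sum_congr rfl fun i _ ↦ Finset.sum_congr rfl fun a _ ↦ ?_
        rw [hk_symm (y a)]; ring
      have h3 : ∑ i, ∑ a, - c i * (n : ℝ)⁻¹ * k (z i) (y a)
          = - ((n : ℝ)⁻¹ * ∑ i, c i * ∑ a, k (z i) (y a)) := by
        simp_rw [Finset.mul_sum, ← Finset.sum_neg_distrib]
        refine Finset.sum_congr rfl fun i _ ↦ Finset.sum_congr rfl fun a _ ↦ ?_
        ring
      have h4 : ∑ i, ∑ j, - c i * - c j * k (z i) (z j) = S := by simp only [neg_mul_neg, hS]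
      rw [h1, h2, h3, h4] at h
      linarith
    have hi1 : Integrable (fun y : Fin n → X ↦ ∑ a, ∑ b, k (y a) (y b))
        (Measure.pi fun _ : Fin n ↦ P) := integrable_finsetSum _ fun i _ ↦
      integrable_finsetSum _ fun j _ ↦ integrable_kernel_eval hk_meas hk_bdd i j
    have hi3 : ∀ i a, Integrable (fun y : Fin n → X ↦ k (z i) (y a))
        (Measure.pi fun _ : Fin n ↦ P) := fun i a ↦
      Integrable.of_mem_Icc 0 K ((hsec i).comp (measurable_pi_apply a)).aemeasurable
        (ae_of_all _ fun _ ↦ hk_bdd _ _)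
    have hi4 : ∀ i, Integrable (fun y : Fin n → X ↦ c i * ∑ a, k (z i) (y a))
        (Measure.pi fun _ : Fin n ↦ P) := fun i ↦
      (integrable_finsetSum _ fun a _ ↦ hi3 i a).const_mul _
    have hi2 : Integrable (fun y : Fin n → X ↦ ∑ i, c i * ∑ a, k (z i) (y a))
        (Measure.pi fun _ : Fin n ↦ P) := integrable_finsetSum _ fun i _ ↦ hi4 i
    have hcross : ∫ y, ∑ i, c i * ∑ a, k (z i) (y a) ∂Measure.pi (fun _ : Fin n ↦ P)
        = n * L := by
      rw [integral_finsetSum _ fun i _ ↦ hi4 i, hL, Finset.mul_sum]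
      refine Finset.sum_congr rfl fun i _ ↦ ?_
      rw [integral_const_mul, integral_finsetSum _ fun a _ ↦ hi3 i a]
      simp_rw [integral_pi_eval _ (hsec i)]
      simp only [Finset.sum_const, Finset.card_univ, Fintype.card_fin, nsmul_eq_mul]
      ring
    have hpos := integral_nonneg_of_ae (μ := Measure.pi fun _ : Fin n ↦ P) (ae_of_all _ hpt)
    rw [integral_add ((hi1.const_mul _).sub' (hi2.const_mul _)) (integrable_const _),
      integral_sub (hi1.const_mul _) (hi2.const_mul _), integral_const_mul, integral_const_mul,
      integral_pi_sum_sum_kernel hk_meas hk_bdd, hcross, ← hκ, ← hD] at hpos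
    simp only [integral_const, probReal_univ, one_smul] at hpos
    refine hpos.trans (le_of_eq ?_)
    field_simp
    ring
  have hlim : Tendsto (fun n : ℕ ↦ κ - 2 * L + S + (D - κ) * (n : ℝ)⁻¹) atTop
      (𝓝 (κ - 2 * L + S + (D - κ) * 0)) :=
    (tendsto_inv_atTop_nhds_zero_nat.const_mul _).const_add _
  rw [mul_zero, add_zero] at hlim
  exact ge_of_tendsto hlim ((eventually_gt_atTop 0).mono key)

end KernelForm

section Triangle

lemma sqrt_sub_sqrt_le_of_forall_nonneg {p q w : ℝ} (hp : 0 ≤ p) (hw : 0 ≤ w)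
    (h : ∀ r : ℝ, 0 ≤ (1 - r) * p + r * q - r * (1 - r) * w) :
    √q - √p ≤ √w := by
  have hd := discrim_le_zero (a := w) (b := q - p - w) (c := p) fun r ↦ by
    have := h r; nlinarith
  rw [discrim] at hd
  have hwp : (√w * √p) ^ 2 = w * p := by rw [mul_pow, Real.sq_sqrt hw, Real.sq_sqrt hp]
  have habs : q - p - w ≤ 2 * (√w * √p) := abs_le_of_sq_le_sq' (by nlinarith) (by positivity) |>.2
  rw [sub_le_iff_le_add]
  refine Real.sqrt_le_iff.2 ⟨by positivity, ?_⟩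
  nlinarith [Real.sq_sqrt hw, Real.sq_sqrt hp]

lemma sum_sum_update_kernel {X : Type*} {k : X → X → ℝ} {n : ℕ} (y : Fin n → X) (i : Fin n)
    (b : X) :
    ∑ j, ∑ l, (k (y j) (y l) - k (y j) (Function.update y i b l)
        - k (Function.update y i b j) (y l)
        + k (Function.update y i b j) (Function.update y i b l))
      = k (y i) (y i) - k (y i) b - k b (y i) + k b b := by
  rw [Finset.sum_eq_single i, Finset.sum_eq_single i]
  · simp
  · intro l _ hl
    simp [Function.update_of_ne hl]
  · simp
  · intro j _ hj
    simp [Function.update_of_ne hj]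
  · simp

end Triangle

section EmpiricalMMD

variable {X : Type*} [MeasurableSpace X] {P : Measure X} [IsProbabilityMeasure P]
  {k : X → X → ℝ} {K : ℝ}

lemma mmdSq_empMeas [Nonempty X] [MeasurableSingletonClass X]
    (hk_meas : Measurable fun p : X × X ↦ k p.1 p.2)
    (hk_symm : ∀ x y, k x y = k y x) (hk_bdd : ∀ x y, k x y ∈ Set.Icc (0 : ℝ) K)
    {m : ℕ} (hm : 0 < m) (y : Fin m → X) :
    mmdSq k P (empMeas m y : Measure X)
      = ∫ x, ∫ x', k x x' ∂P ∂P - 2 * ((m : ℝ)⁻¹ * ∑ i, ∫ x, k (y i) x ∂P)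
        + (m : ℝ)⁻¹ ^ 2 * ∑ i, ∑ j, k (y i) (y j) := by
  have hemp : ∀ g : X → ℝ, ∫ x, g x ∂(empMeas m y : Measure X) = (m : ℝ)⁻¹ * ∑ i, g (y i) :=
    fun g ↦ by
      have hemp : (empMeas m y : Measure X) = (m : ℝ≥0∞)⁻¹ • ∑ i, Measure.dirac (y i) :=
        congrArg (fun Q : ProbabilityMeasure X ↦ (Q : Measure X)) (dif_pos hm)
      rw [hemp, integral_smul_measure, integral_finsetSum_measure fun i _ ↦ integrable_dirac (by simp)]
      simp
  have hsec : ∀ z, Integrable (fun x ↦ k x z) P := fun z ↦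
    Integrable.of_mem_Icc 0 K (hk_meas.comp measurable_prodMk_right).aemeasurable
      (ae_of_all _ fun _ ↦ hk_bdd _ _)
  simp only [mmdSq, hemp]
  rw [integral_const_mul, integral_finsetSum _ fun i _ ↦ hsec (y i)]
  have hswap : ∀ i, ∫ x, k x (y i) ∂P = ∫ x, k (y i) x ∂P := fun i ↦
    integral_congr_ae (ae_of_all _ fun x ↦ hk_symm _ _)
  simp_rw [hswap, ← Finset.mul_sum]
  ring

lemma mmdSq_empMeas_nonneg [Nonempty X] [MeasurableSingletonClass X]
    (hk_meas : Measurable fun p : X × X ↦ k p.1 p.2)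
    (hk_symm : ∀ x y, k x y = k y x)
    (hk_psd : ∀ (N : ℕ) (z : Fin N → X) (c : Fin N → ℝ),
      0 ≤ ∑ i, ∑ j, c i * c j * k (z i) (z j))
    (hk_bdd : ∀ x y, k x y ∈ Set.Icc (0 : ℝ) K)
    {m : ℕ} (hm : 0 < m) (y : Fin m → X) :
    0 ≤ mmdSq k P (empMeas m y : Measure X) := by
  have h := integral_kernel_sub_sum_nonneg (P := P) hk_meas hk_symm hk_psd hk_bdd y
    fun _ ↦ (m : ℝ)⁻¹
  rw [mmdSq_empMeas hk_meas hk_symm hk_bdd hm]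
  simp_rw [← Finset.mul_sum] at h
  rwa [sq]

lemma measurable_mmdSq_empMeas [Nonempty X] [MeasurableSingletonClass X]
    (hk_meas : Measurable fun p : X × X ↦ k p.1 p.2)
    (hk_symm : ∀ x y, k x y = k y x) (hk_bdd : ∀ x y, k x y ∈ Set.Icc (0 : ℝ) K)
    {m : ℕ} (hm : 0 < m) :
    Measurable fun y : Fin m → X ↦ mmdSq k P (empMeas m y : Measure X) := by
  simp only [mmdSq_empMeas hk_meas hk_symm hk_bdd hm]
  have hpot : Measurable fun z ↦ ∫ x, k z x ∂P :=
    (hk_meas.stronglyMeasurable.integral_prod_right').measurable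
  have h1 : Measurable fun y : Fin m → X ↦ ∑ i, ∫ x, k (y i) x ∂P :=
    Finset.measurable_fun_sum _ fun i _ ↦ hpot.comp (measurable_pi_apply i)
  have h2 : Measurable fun y : Fin m → X ↦ ∑ i, ∑ j, k (y i) (y j) :=
    Finset.measurable_fun_sum _ fun i _ ↦ Finset.measurable_fun_sum _ fun j _ ↦
      measurable_kernel_eval hk_meas i j
  exact (((h1.const_mul _).const_mul 2).const_sub _).add (h2.const_mul _)

lemma mmdSq_empMeas_le [Nonempty X] [MeasurableSingletonClass X]
    (hk_meas : Measurable fun p : X × X ↦ k p.1 p.2)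
    (hk_symm : ∀ x y, k x y = k y x) (hk_bdd : ∀ x y, k x y ∈ Set.Icc (0 : ℝ) K)
    {m : ℕ} (hm : 0 < m) (y : Fin m → X) :
    mmdSq k P (empMeas m y : Measure X) ≤ ∫ x, ∫ x', k x x' ∂P ∂P + K := by
  rw [mmdSq_empMeas hk_meas hk_symm hk_bdd hm]
  have h1 : 0 ≤ (m : ℝ)⁻¹ * ∑ i, ∫ x, k (y i) x ∂P :=
    mul_nonneg (by positivity) (Finset.sum_nonneg fun i _ ↦
      integral_nonneg fun x ↦ (hk_bdd _ _).1)
  have h2 : ∑ i, ∑ j, k (y i) (y j) ≤ m ^ 2 * K :=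
    (Finset.sum_le_sum fun i _ ↦ Finset.sum_le_sum fun j _ ↦ (hk_bdd (y i) (y j)).2).trans
      (le_of_eq (by simp; ring))
  have h3 : (m : ℝ)⁻¹ ^ 2 * ∑ i, ∑ j, k (y i) (y j) ≤ K := by
    refine (mul_le_mul_of_nonneg_left h2 (by positivity)).trans (le_of_eq ?_)
    field_simp
  linarith

lemma mmd_empMeas_update_sub_le [Nonempty X] [MeasurableSingletonClass X]
    (hk_meas : Measurable fun p : X × X ↦ k p.1 p.2)
    (hk_symm : ∀ x y, k x y = k y x)
    (hk_psd : ∀ (N : ℕ) (z : Fin N → X) (c : Fin N → ℝ),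
      0 ≤ ∑ i, ∑ j, c i * c j * k (z i) (z j))
    (hk_bdd : ∀ x y, k x y ∈ Set.Icc (0 : ℝ) K)
    {m : ℕ} (hm : 0 < m) (y : Fin m → X) (i : Fin m) (b : X) :
    mmd k P (empMeas m (Function.update y i b) : Measure X) - mmd k P (empMeas m y : Measure X)
      ≤ √(2 * K / m ^ 2) := by
  set y' := Function.update y i b with hy'
  set V := k (y i) (y i) - k (y i) b - k b (y i) + k b b with hV
  have hVnonneg : 0 ≤ V := by
    have h := hk_psd 2 ![y i, b] ![1, -1]
    simp [Fin.sum_univ_two] at h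
    linarith
  have hVle : V ≤ 2 * K := by
    linarith [(hk_bdd (y i) (y i)).2, (hk_bdd (y i) b).1, (hk_bdd b (y i)).1, (hk_bdd b b).2]
  have hVsum := sum_sum_update_kernel (k := k) y i b
  rw [← hV, ← hy'] at hVsum
  simp only [Finset.sum_add_distrib, Finset.sum_sub_distrib] at hVsum
  refine (sqrt_sub_sqrt_le_of_forall_nonneg (w := (m : ℝ)⁻¹ ^ 2 * V)
    (mmdSq_empMeas_nonneg hk_meas hk_symm hk_psd hk_bdd hm y) (by positivity)
    fun r ↦ ?_).trans (Real.sqrt_le_sqrt ?_)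
  · have h := integral_kernel_sub_sum_nonneg (P := P) hk_meas hk_symm hk_psd hk_bdd
      (Sum.elim y y') (Sum.elim (fun _ ↦ (1 - r) * (m : ℝ)⁻¹) fun _ ↦ r * (m : ℝ)⁻¹)
    simp only [Fintype.sum_sum_type, Sum.elim_inl, Sum.elim_inr, Finset.sum_add_distrib,
      ← Finset.mul_sum] at h
    rw [mmdSq_empMeas hk_meas hk_symm hk_bdd hm, mmdSq_empMeas hk_meas hk_symm hk_bdd hm]
    refine h.trans (le_of_eq ?_)
    rw [← hVsum]
    have hcomm : ∑ j, ∑ l, k (y' j) (y l) = ∑ j, ∑ l, k (y j) (y' l) := by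
      rw [Finset.sum_comm]
      simp_rw [fun j l ↦ hk_symm (y' j) (y l)]
    rw [hcomm]
    ring
  · rw [inv_pow, inv_mul_eq_div]
    gcongr

lemma integral_mmd_empMeas_le [Nonempty X] [MeasurableSingletonClass X]
    (hk_meas : Measurable fun p : X × X ↦ k p.1 p.2)
    (hk_symm : ∀ x y, k x y = k y x)
    (hk_psd : ∀ (N : ℕ) (z : Fin N → X) (c : Fin N → ℝ),
      0 ≤ ∑ i, ∑ j, c i * c j * k (z i) (z j))
    (hk_bdd : ∀ x y, k x y ∈ Set.Icc (0 : ℝ) K)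
    {m : ℕ} (hm : 0 < m) {M : ℝ} (hM : ∀ y : Fin m → X, |mmd k P (empMeas m y : Measure X)| ≤ M) :
    ∫ y, mmd k P (empMeas m y : Measure X) ∂Measure.pi (fun _ : Fin m ↦ P) ≤ √(K / m) := by
  set κ := ∫ x, ∫ x', k x x' ∂P ∂P with hκ
  have hm' : (m : ℝ) ≠ 0 := by positivity
  have hκ0 : 0 ≤ κ := integral_nonneg fun x ↦ integral_nonneg fun x' ↦ (hk_bdd x x').1
  have hpot : Measurable fun z ↦ ∫ x, k z x ∂P :=
    (hk_meas.stronglyMeasurable.integral_prod_right').measurable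
  have hi1 : Integrable (fun y : Fin m → X ↦ ∑ a, ∑ b, k (y a) (y b))
      (Measure.pi fun _ : Fin m ↦ P) := integrable_finsetSum _ fun i _ ↦
    integrable_finsetSum _ fun j _ ↦ integrable_kernel_eval hk_meas hk_bdd i j
  have hpot_mem : ∀ z, ∫ x, k z x ∂P ∈ Set.Icc 0 K := fun z ↦
    ⟨integral_nonneg fun x ↦ (hk_bdd _ _).1,
      (integral_mono (Integrable.of_mem_Icc 0 K (hk_meas.comp measurable_prodMk_left).aemeasurable
        (ae_of_all _ fun _ ↦ hk_bdd _ _)) (integrable_const K) fun x ↦ (hk_bdd z x).2).trans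
        (by simp)⟩
  have hi3 : ∀ i : Fin m, Integrable (fun y : Fin m → X ↦ ∫ x, k (y i) x ∂P)
      (Measure.pi fun _ : Fin m ↦ P) := fun i ↦
    Integrable.of_mem_Icc 0 K (hpot.comp (measurable_pi_apply i)).aemeasurable
      (ae_of_all _ fun _ ↦ hpot_mem _)
  have hi2 := integrable_finsetSum (μ := Measure.pi fun _ : Fin m ↦ P) Finset.univ
    fun i _ ↦ hi3 i
  have hsq : ∫ y, mmdSq k P (empMeas m y : Measure X) ∂Measure.pi (fun _ : Fin m ↦ P)
      ≤ K / m := by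
    simp only [mmdSq_empMeas hk_meas hk_symm hk_bdd hm]
    rw [integral_add ((integrable_const _).sub' ((hi2.const_mul _).const_mul _))
      (hi1.const_mul _), integral_sub (integrable_const _) ((hi2.const_mul _).const_mul _),
      integral_const_mul, integral_const_mul, integral_const_mul,
      integral_pi_sum_sum_kernel hk_meas hk_bdd, integral_finsetSum _ fun i _ ↦ hi3 i]
    simp_rw [fun i : Fin m ↦ integral_pi_eval (P := P) i hpot]
    simp only [integral_const, probReal_univ, one_smul, Finset.sum_const, Finset.card_univ,
      Fintype.card_fin, nsmul_eq_mul, ← hκ]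
    have hD := (integral_diag_mem_Icc (P := P) hk_meas hk_bdd).2
    rw [le_div_iff₀ (by positivity)]
    field_simp
    linarith
  set f := fun y : Fin m → X ↦ mmd k P (empMeas m y : Measure X) with hf
  have hfm : Measurable f :=
    (measurable_mmdSq_empMeas hk_meas hk_symm hk_bdd hm).sqrt
  have hL2 : MemLp f 2 (Measure.pi fun _ : Fin m ↦ P) :=
    MemLp.of_bound hfm.aestronglyMeasurable M (ae_of_all _ hM)
  have hvar := variance_nonneg f (Measure.pi fun _ : Fin m ↦ P)
  rw [variance_eq_sub hL2] at hvar
  have hfsq : f ^ 2 = fun y ↦ mmdSq k P (empMeas m y : Measure X) := by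
    ext y
    exact Real.sq_sqrt (mmdSq_empMeas_nonneg hk_meas hk_symm hk_psd hk_bdd hm y)
  rw [hfsq] at hvar
  exact Real.le_sqrt_of_sq_le (by linarith)

end EmpiricalMMD

/-- Concentration of the empirical measure in MMD distance: for a bounded measurable symmetric
positive semidefinite kernel `0 ≤ k ≤ K` on a Polish space and `y_1, …, y_m` i.i.d. with law
`P`, the probability that `d_k(P, P̂_m) > sqrt(2K/m) + ε` is at most `exp(-ε²m/(2K))`. -/
theorem mmd_empirical_concentration {X : Type*} [MeasurableSpace X] [TopologicalSpace X]
    [PolishSpace X] [BorelSpace X] [Nonempty X]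
    (k : X → X → ℝ) (hk_meas : Measurable fun p : X × X => k p.1 p.2)
    (hk_symm : ∀ x y, k x y = k y x)
    (hk_psd : ∀ (N : ℕ) (z : Fin N → X) (c : Fin N → ℝ),
      0 ≤ ∑ i, ∑ j, c i * c j * k (z i) (z j))
    (K : ℝ) (hk_bdd : ∀ x y, k x y ∈ Set.Icc (0 : ℝ) K)
    (P : Measure X) [IsProbabilityMeasure P] (m : ℕ) (hm : 0 < m) (ε : ℝ) (hε : 0 < ε) :
    Measure.pi (fun _ : Fin m => P)
        {y | Real.sqrt (2 * K / m) + ε < mmd k P (empMeas m y : Measure X)}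
      ≤ ENNReal.ofReal (Real.exp (-(ε ^ 2 * m) / (2 * K))) := by
  have hbound : ∀ y : Fin m → X, |mmd k P (empMeas m y : Measure X)|
      ≤ √(∫ x, ∫ x', k x x' ∂P ∂P + K) := fun y ↦ by
    rw [mmd, abs_of_nonneg (Real.sqrt_nonneg _)]
    exact Real.sqrt_le_sqrt (mmdSq_empMeas_le hk_meas hk_symm hk_bdd hm y)
  have hK : 0 ≤ K := (hk_bdd (Classical.arbitrary X) (Classical.arbitrary X)).1.trans
    (hk_bdd _ _).2
  have hmR : (0 : ℝ) < m := by exact_mod_cast hm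
  have hmean := integral_mmd_empMeas_le (P := P) hk_meas hk_symm hk_psd hk_bdd hm hbound
  have hmean' : √(K / m) ≤ √(2 * K / m) := by
    apply Real.sqrt_le_sqrt
    gcongr
    linarith
  have hdev := measure_pi_ge_le_of_boundedDifferences (P := P)
    ((measurable_mmdSq_empMeas hk_meas hk_symm hk_bdd hm).sqrt) hbound
    (fun y i b ↦ mmd_empMeas_update_sub_le hk_meas hk_symm hk_psd hk_bdd hm y i b) hε.le
  rw [Real.sq_sqrt (by positivity)] at hdev
  have hexp : Real.exp (-2 * ε ^ 2 / (m * (2 * K / m ^ 2)))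
      ≤ Real.exp (-(ε ^ 2 * m) / (2 * K)) := by
    rw [Real.exp_le_exp]
    rcases hK.eq_or_lt with rfl | hK
    · simp
    · have h : -2 * ε ^ 2 / (m * (2 * K / m ^ 2)) = 2 * (-(ε ^ 2 * m) / (2 * K)) := by
        field_simp
      have hneg : 0 ≤ ε ^ 2 * m / (2 * K) := by positivity
      rw [h, neg_div]
      linarith
  calc Measure.pi (fun _ : Fin m => P)
        {y | √(2 * K / m) + ε < mmd k P (empMeas m y : Measure X)}
      ≤ Measure.pi (fun _ : Fin m => P) {y | ε ≤ mmd k P (empMeas m y : Measure X)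
          - ∫ y, mmd k P (empMeas m y : Measure X) ∂Measure.pi (fun _ : Fin m => P)} :=
        measure_mono fun y hy ↦ by
          simp only [Set.mem_ofPred_eq] at hy ⊢
          linarith
    _ ≤ ENNReal.ofReal (Real.exp (-(ε ^ 2 * m) / (2 * K))) := by
        rw [← ofReal_measureReal]
        exact ENNReal.ofReal_le_ofReal (hdev.trans hexp)
end
end

section
/- Let X be a Polish, locally compact Hausdorff space, and let k : X × X → ℝ be a bounded continuous symmetric positive semidefinite kernel with 0 ≤ k(·,·) ≤ K for some K > 0, such that the MMD d_k is a metric on P(X) metrizing weak convergence. Let P, Q be Borel probability measures on X. For each n let m = m(n) be such that m(n)/n → ∞ as n → ∞; let y_1,…,y_m be i.i.d. with law P and, independently, x_1,…,x_n i.i.d. with law Q, with empirical measures P̂_m and Q̂_n. Fix α ∈ (0,1) and set γ_{m,n} = (sqrt(K/m) + sqrt(K/n))·(2 + sqrt(2·log(2/α))). Then: (1) if Q = P, for all m, n, Prob(d_k(P̂_m, Q̂_n) > γ_{m,n}) ≤ α; and (2) if 0 < D(P‖Q) < ∞, then liminf_{n→∞} −(1/n) log Prob(d_k(P̂_m, Q̂_n)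 ≤ γ_{m,n}) = D(P‖Q). -/
open MeasureTheory Filter Topology ENNReal
open scoped Classical

noncomputable section
/-- The Kullback-Leibler divergence `D(P‖Q) ∈ [0,∞]`: it equals `∫ log (dP/dQ) dP` when
`P ≪ Q` (and the integral is well defined), and `+∞` otherwise. -/
def klDiv {X : Type*} [MeasurableSpace X] (P Q : Measure X) : ℝ≥0∞ :=
  if P ≪ Q ∧ Integrable (llr P Q) P then ENNReal.ofReal (∫ x, llr P Q x ∂P) else ⊤
/-- The exponential decay rate `-(1/n) log p` of a probability `p`, valued in `EReal`
(with `-(1/n) log 0 = ⊤`). -/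
def expRate (n : ℕ) (p : ℝ≥0∞) : EReal := -((((n : ℝ)⁻¹ : ℝ) : EReal) * ENNReal.log p)

lemma measurePreserving_finCons {X : Type*} [MeasurableSpace X] (μ : Measure X)
    [IsProbabilityMeasure μ] (n : ℕ) :
    MeasurePreserving (fun p : X × (Fin n → X) => (Fin.cons p.1 p.2 : Fin (n + 1) → X))
      (μ.prod (Measure.pi fun _ => μ)) (Measure.pi fun _ => μ) := by
  have h := (measurePreserving_piFinSuccAbove (fun _ : Fin (n + 1) => μ) 0).symm
  convert h using 1
  ext p : 1
  simp [MeasurableEquiv.piFinSuccAbove_symm_apply, Fin.insertNthEquiv]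

/-- The exponential moment bound behind McDiarmid's bounded differences inequality. -/
lemma integral_exp_le_of_bounded_differences {X : Type*} [MeasurableSpace X] (μ : Measure X)
    [IsProbabilityMeasure μ] (n : ℕ) (f : (Fin n → X) → ℝ) (hf : Measurable f) (B : ℝ)
    (hB : ∀ x, |f x| ≤ B) (c : ℝ) (hc0 : 0 ≤ c)
    (hc : ∀ i x a, f (Function.update x i a) ≤ f x + c) (t : ℝ) :
    ∫ x, Real.exp (t * (f x - ∫ z, f z ∂(Measure.pi fun _ => μ))) ∂(Measure.pi fun _ => μ)
      ≤ Real.exp (n * (t ^ 2 * c ^ 2 / 8)) := by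
  induction n with
  | zero =>
    obtain ⟨b, rfl⟩ : ∃ b, f = fun _ => b :=
      ⟨f default, funext fun x => congrArg f (Subsingleton.elim _ _)⟩
    simp
  | succ n ih =>
    have : Nonempty X := nonempty_of_isProbabilityMeasure μ
    set ν : Measure (Fin n → X) := Measure.pi fun _ => μ with hν
    have hcons : Measurable fun p : X × (Fin n → X) => (Fin.cons p.1 p.2 : Fin (n + 1) → X) :=
      (measurePreserving_finCons μ n).measurable
    have hfc : Measurable fun p : X × (Fin n → X) => f (Fin.cons p.1 p.2) := hf.comp hcons
    have h_int : ∀ φ : (Fin (n + 1) → X) → ℝ, Measurable φ →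
        ∫ x, φ x ∂(Measure.pi fun _ => μ) = ∫ p, φ (Fin.cons p.1 p.2) ∂(μ.prod ν) := by
      intro φ hφ
      rw [← (measurePreserving_finCons μ n).map_eq,
        integral_map hcons.aemeasurable hφ.aestronglyMeasurable]
    have hbdd : ∀ {Y : Type _} [MeasurableSpace Y] (ρ : Measure Y) [IsProbabilityMeasure ρ]
        (φ : Y → ℝ) (C : ℝ), Measurable φ → (∀ y, |φ y| ≤ C) → Integrable φ ρ := by
      intro Y _ ρ _ φ C hφ hC
      exact Integrable.of_bound hφ.aestronglyMeasurable C (Eventually.of_forall hC)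
    set g : X → ℝ := fun a => ∫ z, f (Fin.cons a z) ∂ν with hg
    have hgm : Measurable g := hfc.stronglyMeasurable.integral_prod_right.measurable
    have hfa : ∀ a, Measurable fun z : Fin n → X => f (Fin.cons a z) := fun a =>
      hfc.comp measurable_prodMk_left
    have hfai : ∀ a, Integrable (fun z : Fin n → X => f (Fin.cons a z)) ν := fun a =>
      hbdd ν _ B (hfa a) fun z => hB _
    have hE : ∫ x, f x ∂(Measure.pi fun _ => μ) = ∫ a, g a ∂μ := by
      rw [h_int f hf, integral_prod _ (hbdd _ _ B hfc fun p => hB _)]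
    have hgle : ∀ a b, g a ≤ g b + c := by
      intro a b
      have h1 : ∀ z : Fin n → X, f (Fin.cons a z) ≤ f (Fin.cons b z) + c := by
        intro z
        have := hc 0 (Fin.cons b z) a
        rwa [Fin.update_cons_zero] at this
      calc g a ≤ ∫ z, (f (Fin.cons b z) + c) ∂ν :=
            integral_mono (hfai a) ((hfai b).add (integrable_const c)) h1
        _ = g b + c := by
            rw [integral_add (hfai b) (integrable_const c)]; simp [hg]
    have hbb : BddBelow (Set.range g) := by
      obtain ⟨a⟩ := this
      refine ⟨g a - c, ?_⟩
      rintro _ ⟨b, rfl⟩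
      linarith [hgle a b]
    have hgIcc : ∀ a, g a ∈ Set.Icc (⨅ b, g b) ((⨅ b, g b) + c) := by
      intro a
      refine ⟨ciInf_le hbb a, ?_⟩
      have : g a - c ≤ ⨅ b, g b := le_ciInf fun b => by linarith [hgle a b]
      linarith
    have hH := ProbabilityTheory.hasSubgaussianMGF_of_mem_Icc (μ := μ) hgm.aemeasurable
      (Eventually.of_forall hgIcc)
    have hH' : ∫ a, Real.exp (t * (g a - ∫ a, g a ∂μ)) ∂μ ≤ Real.exp (t ^ 2 * c ^ 2 / 8) := by
      have := hH.mgf_le t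
      unfold ProbabilityTheory.mgf at this
      refine this.trans (le_of_eq ?_)
      congr 1
      simp only [add_sub_cancel_left, NNReal.coe_pow, NNReal.coe_div, coe_nnnorm, Real.norm_eq_abs,
        abs_of_nonneg hc0, NNReal.coe_ofNat]
      ring
    rw [hE]
    set m := ∫ a, g a ∂μ with hm
    have hexpm : Measurable fun x => Real.exp (t * (f x - m)) := by fun_prop
    have hexpB : ∀ s : ℝ, |s| ≤ B → |Real.exp (t * (s - m))| ≤ Real.exp (|t| * (B + |m|)) := by
      intro s hs
      rw [abs_of_pos (Real.exp_pos _), Real.exp_le_exp]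
      calc t * (s - m) ≤ |t * (s - m)| := le_abs_self _
        _ = |t| * |s - m| := abs_mul _ _
        _ ≤ |t| * (B + |m|) := by
          gcongr
          exact (abs_sub _ _).trans (by gcongr)
    have hexpc : Measurable fun p : X × (Fin n → X) => Real.exp (t * (f (Fin.cons p.1 p.2) - m)) :=
      hexpm.comp hcons
    have hexpi := hbdd (μ.prod ν) _ _ hexpc fun p => hexpB _ (hB (Fin.cons p.1 p.2))
    rw [h_int _ hexpm, integral_prod _ hexpi]
    have hgB : ∀ a, |g a| ≤ B := fun a => by
      have := norm_integral_le_of_norm_le_const (μ := ν) (f := fun z => f (Fin.cons a z)) (C := B)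
        (Eventually.of_forall fun z => hB _)
      simpa using this
    have hstep : ∀ a, ∫ z, Real.exp (t * (f (Fin.cons a z) - m)) ∂ν
        ≤ Real.exp (n * (t ^ 2 * c ^ 2 / 8)) * Real.exp (t * (g a - m)) := by
      intro a
      have h1 := ih (fun z => f (Fin.cons a z)) (hfa a) (fun z => hB _) (fun i z b => by
        have := hc i.succ (Fin.cons a z) b
        rwa [← Fin.cons_update] at this)
      have h2 : ∀ z : Fin n → X, Real.exp (t * (f (Fin.cons a z) - m))
          = Real.exp (t * (f (Fin.cons a z) - g a)) * Real.exp (t * (g a - m)) := by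
        intro z
        rw [← Real.exp_add]; congr 1; ring
      simp_rw [h2]
      rw [integral_mul_const]
      gcongr
    have hgexp : Integrable (fun a => Real.exp (t * (g a - m))) μ :=
      hbdd μ _ _ (by fun_prop) fun a => hexpB _ (hgB a)
    calc ∫ a, ∫ z, Real.exp (t * (f (Fin.cons a z) - m)) ∂ν ∂μ
        ≤ ∫ a, Real.exp (n * (t ^ 2 * c ^ 2 / 8)) * Real.exp (t * (g a - m)) ∂μ :=
          integral_mono hexpi.integral_prod_left (hgexp.const_mul _) hstep
      _ = Real.exp (n * (t ^ 2 * c ^ 2 / 8)) * ∫ a, Real.exp (t * (g a - m)) ∂μ :=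
          integral_const_mul _ _
      _ ≤ Real.exp (n * (t ^ 2 * c ^ 2 / 8)) * Real.exp (t ^ 2 * c ^ 2 / 8) := by gcongr
      _ = _ := by rw [← Real.exp_add]; congr 1; push_cast; ring

/-- McDiarmid's bounded differences inequality. -/
lemma measure_ge_le_of_bounded_differences {X : Type*} [MeasurableSpace X] (μ : Measure X)
    [IsProbabilityMeasure μ] (n : ℕ) (f : (Fin n → X) → ℝ) (hf : Measurable f) (B : ℝ)
    (hB : ∀ x, |f x| ≤ B) (c : ℝ) (hc0 : 0 ≤ c)
    (hc : ∀ i x a, f (Function.update x i a) ≤ f x + c) {ε : ℝ} (hε : 0 ≤ ε) :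
    (Measure.pi fun _ : Fin n => μ).real
        {x | (∫ z, f z ∂(Measure.pi fun _ => μ)) + ε ≤ f x}
      ≤ Real.exp (-(2 * ε ^ 2 / (n * c ^ 2))) := by
  set ν : Measure (Fin n → X) := Measure.pi fun _ => μ with hν
  set e := ∫ z, f z ∂ν with he
  have hsub : ProbabilityTheory.HasSubgaussianMGF (fun x => f x - e)
      (Real.toNNReal (n * c ^ 2 / 4)) ν := by
    constructor
    · intro t
      refine ProbabilityTheory.integrable_exp_mul_of_mem_Icc (a := -B - e) (b := B - e)
        (by fun_prop) (Eventually.of_forall fun x => ?_)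
      have := abs_le.1 (hB x)
      constructor <;> linarith [this.1, this.2]
    · intro t
      refine (integral_exp_le_of_bounded_differences μ n f hf B hB c hc0 hc t).trans (le_of_eq ?_)
      rw [Real.coe_toNNReal _ (by positivity)]
      congr 1; ring
  have h := hsub.measure_ge_le hε
  rw [Real.coe_toNNReal _ (by positivity)] at h
  convert h using 2
  · ext x; simp only [Set.mem_ofPred_eq]; constructor <;> intro h <;> linarith
  · rw [neg_div]
    congr 1
    rw [show 2 * ((n : ℝ) * c ^ 2 / 4) = (n * c ^ 2) / 2 by ring, div_div_eq_mul_div]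
    ring

lemma integral_empMeas {X : Type*} [MeasurableSpace X] [Nonempty X] [MeasurableSingletonClass X]
    {n : ℕ} (hn : 0 < n) (x : Fin n → X) (g : X → ℝ) :
    ∫ y, g y ∂(empMeas n x : Measure X) = (n : ℝ)⁻¹ * ∑ i, g (x i) := by
  have h : (empMeas n x : Measure X) = (n : ℝ≥0∞)⁻¹ • ∑ i, Measure.dirac (x i) :=
    congrArg Subtype.val (dif_pos hn)
  rw [h, integral_smul_measure, integral_finsetSum_measure]
  · simp
  · intro i _
    exact integrable_dirac (by simp)

lemma mmdSq_empMeas_empMeas {X : Type*} [MeasurableSpace X] [Nonempty X]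
    [MeasurableSingletonClass X] (k : X → X → ℝ) {n : ℕ} (hn : 0 < n) (y z : Fin n → X) :
    mmdSq k (empMeas n y : Measure X) (empMeas n z : Measure X)
      = ((n : ℝ)⁻¹) ^ 2 * ∑ i, ∑ j,
          (k (y i) (y j) + k (z i) (z j) - 2 * k (y i) (z j)) := by
  unfold mmdSq
  simp only [integral_empMeas hn, Finset.sum_sub_distrib, Finset.sum_add_distrib,
    ← Finset.mul_sum]
  ring

lemma mmdSq_empMeas_left {X : Type*} [MeasurableSpace X] [Nonempty X]
    [MeasurableSingletonClass X] (k : X → X → ℝ) {n : ℕ} (hn : 0 < n) (y : Fin n → X)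
    (P : Measure X) :
    mmdSq k (empMeas n y : Measure X) P
      = ((n : ℝ)⁻¹) ^ 2 * ∑ i, ∑ j, k (y i) (y j) + (∫ x, ∫ x', k x x' ∂P ∂P)
        - 2 * ((n : ℝ)⁻¹ * ∑ i, ∫ x, k (y i) x ∂P) := by
  unfold mmdSq
  simp only [integral_empMeas hn, ← Finset.mul_sum]
  ring

lemma integrable_of_measurable_bounded {Y : Type*} [MeasurableSpace Y] (ρ : Measure Y)
    [IsFiniteMeasure ρ] {φ : Y → ℝ} {C : ℝ} (hφ : Measurable φ) (hC : ∀ y, |φ y| ≤ C) :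
    Integrable φ ρ :=
  Integrable.of_bound hφ.aestronglyMeasurable C (Eventually.of_forall hC)

lemma mmdSq_comm {X : Type*} [MeasurableSpace X] (k : X → X → ℝ)
    (hkm : Measurable fun p : X × X => k p.1 p.2) (hk_symm : ∀ x y, k x y = k y x)
    (K : ℝ) (hkb : ∀ x y, |k x y| ≤ K) (P Q : Measure X) [IsFiniteMeasure P] [IsFiniteMeasure Q] :
    mmdSq k P Q = mmdSq k Q P := by
  have h : ∫ y, ∫ x, k y x ∂Q ∂P = ∫ x, ∫ y, k x y ∂P ∂Q := by
    rw [integral_integral_swap (integrable_of_measurable_bounded _ hkm fun p => hkb _ _)]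
    simp_rw [hk_symm]
  unfold mmdSq
  rw [h]; ring

/-- Expectation of the random part of the squared MMD between an empirical measure and a fixed
measure. -/
lemma integral_pi_quadratic {X : Type*} [MeasurableSpace X] (k : X → X → ℝ)
    (hkm : Measurable fun p : X × X => k p.1 p.2) (K : ℝ) (hkb : ∀ x y, |k x y| ≤ K)
    (P : Measure X) [IsProbabilityMeasure P] (h : X → ℝ) (hh : Measurable h) (C : ℝ)
    (hhC : ∀ x, |h x| ≤ C) {n : ℕ} (hn : 0 < n) (c : ℝ) :
    ∫ z, (((n : ℝ)⁻¹) ^ 2 * ∑ i, ∑ j, k (z i) (z j) + c - 2 * ((n : ℝ)⁻¹ * ∑ i, h (z i)))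
        ∂(Measure.pi fun _ : Fin n => P)
      = (n : ℝ)⁻¹ * ((∫ x, k x x ∂P) - ∫ x, ∫ x', k x x' ∂P ∂P)
        + (∫ x, ∫ x', k x x' ∂P ∂P) + c - 2 * ∫ x, h x ∂P := by
  set ν := Measure.pi fun _ : Fin n => P with hν
  set A := ∫ x, ∫ x', k x x' ∂P ∂P with hA
  set D := ∫ x, k x x ∂P with hD
  have hdiag : Measurable fun x => k x x := hkm.comp (measurable_id.prodMk measurable_id)
  have hpair : ∀ i j : Fin n, Measurable fun z : Fin n → X => k (z i) (z j) := fun i j =>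
    hkm.comp (f := fun z : Fin n → X => (z i, z j))
      ((measurable_pi_apply i).prodMk (measurable_pi_apply j))
  have hkint : ∀ i j : Fin n, Integrable (fun z : Fin n → X => k (z i) (z j)) ν := fun i j =>
    integrable_of_measurable_bounded _ (hpair i j) fun z => hkb _ _
  have hhint : ∀ i : Fin n, Integrable (fun z : Fin n → X => h (z i)) ν := fun i =>
    integrable_of_measurable_bounded _ (hh.comp (measurable_pi_apply i)) fun z => hhC _
  have hone : ∀ (φ : X → ℝ), Measurable φ → ∀ i : Fin n, ∫ z, φ (z i) ∂ν = ∫ x, φ x ∂P := by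
    intro φ hφ i
    have hmp := measurePreserving_eval (fun _ : Fin n => P) i
    rw [← hmp.map_eq, integral_map hmp.measurable.aemeasurable hφ.aestronglyMeasurable]
  have htwo : ∀ i j : Fin n, ∫ z, k (z i) (z j) ∂ν = A + if i = j then D - A else 0 := by
    intro i j
    split_ifs with hij
    · subst hij
      rw [hone _ hdiag i]; ring
    · have hmap := Measure.infinitePi_map_eval_prod (P := fun _ : Fin n => P) hij
      rw [Measure.infinitePi_eq_pi] at hmap
      have : ∫ p, k p.1 p.2 ∂(P.prod P) = A :=
        integral_prod _ (integrable_of_measurable_bounded _ hkm fun p => hkb _ _)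
      rw [add_zero, ← this, ← hmap,
        integral_map (by fun_prop) hkm.aestronglyMeasurable]
  have hn' : (n : ℝ) ≠ 0 := by positivity
  rw [integral_sub, integral_add, integral_const_mul, integral_const_mul, integral_const_mul,
    integral_finsetSum, integral_finsetSum]
  · simp_rw [integral_finsetSum _ fun j _ => hkint _ j, htwo, hone h hh]
    simp only [Finset.sum_add_distrib, Finset.sum_const, Finset.card_univ, Fintype.card_fin,
      nsmul_eq_mul, Finset.sum_ite_eq, Finset.mem_univ, if_true, integral_const, probReal_univ,
      smul_eq_mul]
    field_simp
    ring
  · exact fun i _ => hhint i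
  · exact fun i _ => integrable_finsetSum _ fun j _ => hkint i j
  · exact (integrable_finsetSum _ fun i _ => integrable_finsetSum _ fun j _ =>
      hkint i j).const_mul _
  · exact integrable_const _
  · exact ((integrable_finsetSum _ fun i _ => integrable_finsetSum _ fun j _ =>
      hkint i j).const_mul _).add (integrable_const _)
  · exact ((integrable_finsetSum _ fun i _ => hhint i).const_mul _).const_mul _

lemma mmdSq_empMeas_empMeas_nonneg {X : Type*} (k : X → X → ℝ)
    (hk_symm : ∀ x y, k x y = k y x)
    (hk_psd : ∀ (N : ℕ) (z : Fin N → X) (c : Fin N → ℝ),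
      0 ≤ ∑ i, ∑ j, c i * c j * k (z i) (z j))
    (n m : ℕ) (y : Fin n → X) (z : Fin m → X) (a b : ℝ) :
    0 ≤ a ^ 2 * ∑ i, ∑ j, k (y i) (y j) + b ^ 2 * ∑ i, ∑ j, k (z i) (z j)
      - 2 * (a * b * ∑ i, ∑ j, k (y i) (z j)) := by
  have h := hk_psd (n + m) (Fin.append y z) (Fin.append (fun _ => a) (fun _ => -b))
  simp only [Fin.sum_univ_add, Fin.append_left, Fin.append_right, Finset.sum_add_distrib] at h
  have e1 : ∑ i, ∑ j, -b * a * k (z i) (y j) = -(a * b * ∑ i, ∑ j, k (y i) (z j)) := by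
    rw [Finset.sum_comm, Finset.mul_sum, ← Finset.sum_neg_distrib]
    refine Finset.sum_congr rfl fun i _ => ?_
    rw [Finset.mul_sum, ← Finset.sum_neg_distrib]
    exact Finset.sum_congr rfl fun j _ => by rw [hk_symm]; ring
  have e2 : ∑ i, ∑ j, a * -b * k (y i) (z j) = -(a * b * ∑ i, ∑ j, k (y i) (z j)) := by
    simp only [← Finset.mul_sum]; ring
  rw [e1, e2] at h
  simp only [← Finset.mul_sum] at h
  linarith [h]

lemma mmdSq_empMeas_left_nonneg {X : Type*} [MeasurableSpace X] [Nonempty X]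
    [MeasurableSingletonClass X] (k : X → X → ℝ)
    (hkm : Measurable fun p : X × X => k p.1 p.2) (hk_symm : ∀ x y, k x y = k y x)
    (hk_psd : ∀ (N : ℕ) (z : Fin N → X) (c : Fin N → ℝ),
      0 ≤ ∑ i, ∑ j, c i * c j * k (z i) (z j))
    (K : ℝ) (hkb : ∀ x y, |k x y| ≤ K)
    (P : Measure X) [IsProbabilityMeasure P] {n : ℕ} (hn : 0 < n) (y : Fin n → X) :
    0 ≤ mmdSq k (empMeas n y : Measure X) P := by
  have hks : ∀ x, Measurable (k x) := fun x => hkm.comp measurable_prodMk_left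
  set S := ((n : ℝ)⁻¹) ^ 2 * ∑ i, ∑ j, k (y i) (y j) with hS
  set h : X → ℝ := fun x => (n : ℝ)⁻¹ * ∑ i, k (y i) x with hh
  have hhm : Measurable h := (Finset.measurable_fun_sum _ fun i _ => hks (y i)).const_mul _
  have hhC : ∀ x, |h x| ≤ (n : ℝ)⁻¹ * ∑ _i : Fin n, K := by
    intro x
    rw [hh, abs_mul, abs_of_nonneg (by positivity : (0 : ℝ) ≤ (n : ℝ)⁻¹)]
    gcongr
    exact (Finset.abs_sum_le_sum_abs _ _).trans (Finset.sum_le_sum fun i _ => hkb _ _)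
  have h_int : ∫ x, h x ∂P = (n : ℝ)⁻¹ * ∑ i, ∫ x, k (y i) x ∂P := by
    rw [integral_const_mul, integral_finsetSum]
    exact fun i _ => integrable_of_measurable_bounded _ (hks _) fun x => hkb _ _
  set E := (∫ x, k x x ∂P) - ∫ x, ∫ x', k x x' ∂P ∂P with hE
  have key : ∀ N : ℕ, 0 ≤ ((N + 1 : ℕ) : ℝ)⁻¹ * E + mmdSq k (empMeas n y : Measure X) P := by
    intro N
    have h1 := integral_pi_quadratic k hkm K hkb P h hhm _ hhC N.succ_pos S
    have h2 : 0 ≤ ∫ z, ((((N + 1 : ℕ) : ℝ)⁻¹) ^ 2 * ∑ i, ∑ j, k (z i) (z j) + S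
        - 2 * ((((N + 1 : ℕ) : ℝ)⁻¹) * ∑ i, h (z i))) ∂(Measure.pi fun _ : Fin (N + 1) => P) := by
      refine integral_nonneg fun z => ?_
      have h3 := mmdSq_empMeas_empMeas_nonneg k hk_symm hk_psd n (N + 1) y z (n : ℝ)⁻¹
        (((N + 1 : ℕ) : ℝ)⁻¹)
      have h4 : ∑ j, h (z j) = (n : ℝ)⁻¹ * ∑ i, ∑ j, k (y i) (z j) := by
        rw [hh, ← Finset.mul_sum, Finset.sum_comm]
      simp only [Pi.zero_apply]
      rw [h4]
      linarith [h3]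
    rw [h1, h_int] at h2
    rw [mmdSq_empMeas_left k hn]
    linarith [h2]
  have hlim : Tendsto (fun N : ℕ => ((N + 1 : ℕ) : ℝ)⁻¹ * E + mmdSq k (empMeas n y : Measure X) P)
      atTop (𝓝 (0 * E + mmdSq k (empMeas n y : Measure X) P)) :=
    ((tendsto_inv_atTop_nhds_zero_nat.comp (tendsto_add_atTop_nat 1)).mul_const E).add_const _
  have := ge_of_tendsto' hlim key
  simpa using this

lemma mmd_empMeas_update_le {X : Type*} [MeasurableSpace X] [Nonempty X]
    [MeasurableSingletonClass X] (k : X → X → ℝ) (hk_symm : ∀ x y, k x y = k y x)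
    (K : ℝ) (hkb : ∀ x y, |k x y| ≤ K) {n : ℕ} (hn : 0 < n) (y : Fin n → X) (l : Fin n) (a : X) :
    mmd k (empMeas n (Function.update y l a) : Measure X) (empMeas n y : Measure X)
      ≤ (n : ℝ)⁻¹ * (2 * Real.sqrt K) := by
  have hK : 0 ≤ K := (abs_nonneg _).trans (hkb a a)
  set y' := Function.update y l a with hy'
  have hne : ∀ i, i ≠ l → y' i = y i := fun i hi => Function.update_of_ne hi _ _
  have hl : y' l = a := Function.update_self _ _ _
  have hs : ∑ i, ∑ j, (k (y' i) (y' j) + k (y i) (y j) - 2 * k (y' i) (y j))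
      = ∑ i, ∑ j, (k (y' i) (y' j) + k (y i) (y j) - k (y' i) (y j) - k (y i) (y' j)) := by
    have : ∑ i, ∑ j, k (y' i) (y j) = ∑ i, ∑ j, k (y i) (y' j) := by
      rw [Finset.sum_comm]; simp_rw [hk_symm]
    simp only [Finset.sum_sub_distrib, Finset.sum_add_distrib, ← Finset.mul_sum]
    linarith
  have hs' : ∑ i, ∑ j, (k (y' i) (y' j) + k (y i) (y j) - k (y' i) (y j) - k (y i) (y' j))
      = k a a + k (y l) (y l) - k a (y l) - k (y l) a := by
    rw [Finset.sum_eq_single l, Finset.sum_eq_single l, hl]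
    · intro j _ hj; rw [hne j hj]; ring
    · simp
    · intro i _ hi
      refine Finset.sum_eq_zero fun j _ => ?_
      rw [hne i hi]; ring
    · simp
  unfold mmd
  rw [mmdSq_empMeas_empMeas k hn, hs, hs']
  refine Real.sqrt_le_iff.2 ⟨by positivity, ?_⟩
  rw [mul_pow, mul_pow, Real.sq_sqrt hK]
  gcongr
  linarith [abs_le.1 (hkb a a), abs_le.1 (hkb (y l) (y l)), abs_le.1 (hkb a (y l)),
    abs_le.1 (hkb (y l) a), le_of_abs_le (hkb a a), le_of_abs_le (hkb (y l) (y l)),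
    neg_le_of_abs_le (hkb a (y l)), neg_le_of_abs_le (hkb (y l) a)]

lemma measurable_mmd_empMeas_left {X : Type*} [MeasurableSpace X] [Nonempty X]
    [MeasurableSingletonClass X] (k : X → X → ℝ)
    (hkm : Measurable fun p : X × X => k p.1 p.2) (P : Measure X) [SFinite P]
    {n : ℕ} (hn : 0 < n) :
    Measurable fun y : Fin n → X => mmd k (empMeas n y : Measure X) P := by
  unfold mmd
  simp_rw [mmdSq_empMeas_left k hn]
  have h1 : Measurable fun x => ∫ x', k x x' ∂P :=
    hkm.stronglyMeasurable.integral_prod_right.measurable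
  have hpair : ∀ i j : Fin n, Measurable fun z : Fin n → X => k (z i) (z j) := fun i j =>
    hkm.comp (f := fun z : Fin n → X => (z i, z j))
      ((measurable_pi_apply i).prodMk (measurable_pi_apply j))
  have h1' : ∀ i : Fin n, Measurable fun z : Fin n → X => ∫ x', k (z i) x' ∂P := fun i =>
    h1.comp (measurable_pi_apply i)
  fun_prop

/-- Concentration of the MMD between an empirical measure and the sampling law. -/
lemma measure_mmd_empMeas_ge_le {X : Type*} [MeasurableSpace X] [Nonempty X]
    [MeasurableSingletonClass X] (k : X → X → ℝ)
    (hkm : Measurable fun p : X × X => k p.1 p.2) (hk_symm : ∀ x y, k x y = k y x)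
    (hk_psd : ∀ (N : ℕ) (z : Fin N → X) (c : Fin N → ℝ),
      0 ≤ ∑ i, ∑ j, c i * c j * k (z i) (z j))
    (K : ℝ) (hK : 0 < K) (hk_bdd : ∀ x y, k x y ∈ Set.Icc (0 : ℝ) K)
    (h_tri : ∀ R S T : ProbabilityMeasure X,
      mmd k (R : Measure X) (T : Measure X)
        ≤ mmd k (R : Measure X) (S : Measure X) + mmd k (S : Measure X) (T : Measure X))
    (P : ProbabilityMeasure X) {n : ℕ} (hn : 0 < n) {ε : ℝ} (hε : 0 ≤ ε) :
    (Measure.pi fun _ : Fin n => (P : Measure X))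
        {y | Real.sqrt (K / n) + ε ≤ mmd k (empMeas n y : Measure X) (P : Measure X)}
      ≤ ENNReal.ofReal (Real.exp (-(n * ε ^ 2 / (2 * K)))) := by
  have hkb : ∀ x y, |k x y| ≤ K := fun x y =>
    (abs_of_nonneg (hk_bdd x y).1).le.trans (hk_bdd x y).2
  have hn' : (0 : ℝ) < n := by exact_mod_cast hn
  set ν := Measure.pi fun _ : Fin n => (P : Measure X) with hν
  set f : (Fin n → X) → ℝ := fun y => mmd k (empMeas n y : Measure X) (P : Measure X) with hf
  have hfm : Measurable f := measurable_mmd_empMeas_left k hkm _ hn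
  have h_int0 : ∀ (g : X → ℝ), (∀ x, g x ∈ Set.Icc 0 K) →
      ∫ x, g x ∂(P : Measure X) ∈ Set.Icc 0 K := by
    intro g hg
    refine ⟨integral_nonneg fun x => (hg x).1, ?_⟩
    have := norm_integral_le_of_norm_le_const (μ := (P : Measure X)) (f := g) (C := K)
      (Eventually.of_forall fun x => by
        rw [Real.norm_eq_abs, abs_of_nonneg (hg x).1]; exact (hg x).2)
    simpa using (le_abs_self _).trans this
  have hA := h_int0 _ fun x => h_int0 _ fun x' => hk_bdd x x'
  have hD := h_int0 _ fun x => hk_bdd x x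
  have hsq : ∀ y, f y ^ 2 = mmdSq k (empMeas n y : Measure X) (P : Measure X) := fun y =>
    Real.sq_sqrt (mmdSq_empMeas_left_nonneg k hkm hk_symm hk_psd K hkb P hn y)
  have hupper : ∀ y, f y ^ 2 ≤ 2 * K := by
    intro y
    rw [hsq, mmdSq]
    simp only [integral_empMeas hn, ← Finset.mul_sum]
    have h1 : (n : ℝ)⁻¹ * ((n : ℝ)⁻¹ * ∑ i, ∑ j, k (y i) (y j)) ≤ K := by
      have : ∑ i, ∑ j, k (y i) (y j) ≤ ∑ _i : Fin n, ∑ _j : Fin n, K :=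
        Finset.sum_le_sum fun i _ => Finset.sum_le_sum fun j _ => (hk_bdd _ _).2
      simp only [Finset.sum_const, Finset.card_univ, Fintype.card_fin, nsmul_eq_mul] at this
      calc _ ≤ (n : ℝ)⁻¹ * ((n : ℝ)⁻¹ * (n * (n * K))) := by gcongr
        _ = K := by field_simp
    have h2 : 0 ≤ (n : ℝ)⁻¹ * ∑ i, ∫ x, k (y i) x ∂(P : Measure X) :=
      mul_nonneg (by positivity) (Finset.sum_nonneg fun i _ =>
        integral_nonneg fun x => (hk_bdd _ _).1)
    linarith [hA.2]
  have hfB : ∀ y, |f y| ≤ Real.sqrt (2 * K) := fun y => Real.abs_le_sqrt (hupper y)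
  have hfc : ∀ i y a, f (Function.update y i a) ≤ f y + (n : ℝ)⁻¹ * (2 * Real.sqrt K) := by
    intro i y a
    refine (h_tri _ (empMeas n y) _).trans ?_
    linarith [mmd_empMeas_update_le k hk_symm K hkb hn y i a]
  have hmean : ∫ y, f y ∂ν ≤ Real.sqrt (K / n) := by
    refine Real.le_sqrt_of_sq_le ?_
    have hvar := ProbabilityTheory.variance_nonneg f ν
    rw [ProbabilityTheory.variance_eq_sub
      (MemLp.of_bound hfm.aestronglyMeasurable _ (Eventually.of_forall hfB))] at hvar
    have h2 : ∫ y, f y ^ 2 ∂ν ≤ K / n := by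
      simp_rw [hsq, mmdSq_empMeas_left k hn]
      rw [integral_pi_quadratic k hkm K hkb (P : Measure X) (fun x => ∫ x', k x x' ∂(P : Measure X))
        hkm.stronglyMeasurable.integral_prod_right.measurable K
        (fun x => by
          have := h_int0 _ fun x' => hk_bdd x x'
          rw [abs_of_nonneg this.1]; exact this.2) hn]
      have : (n : ℝ)⁻¹ * ((∫ x, k x x ∂(P : Measure X))
          - ∫ x, ∫ x', k x x' ∂(P : Measure X) ∂(P : Measure X)) ≤ (n : ℝ)⁻¹ * K := by
        gcongr
        linarith [hA.1, hD.2]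
      rw [div_eq_inv_mul]
      linarith
    have h3 : ∫ y, (f ^ 2) y ∂ν = ∫ y, f y ^ 2 ∂ν := rfl
    rw [h3] at hvar
    linarith
  have hM := measure_ge_le_of_bounded_differences (P : Measure X) n f hfm _ hfB
    ((n : ℝ)⁻¹ * (2 * Real.sqrt K)) (by positivity) hfc hε
  have hexp : 2 * ε ^ 2 / (n * ((n : ℝ)⁻¹ * (2 * Real.sqrt K)) ^ 2) = n * ε ^ 2 / (2 * K) := by
    rw [mul_pow, mul_pow, Real.sq_sqrt hK.le]
    field_simp
  rw [hexp] at hM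
  calc ν {y | Real.sqrt (K / n) + ε ≤ f y} ≤ ν {y | (∫ z, f z ∂ν) + ε ≤ f y} := by
        refine measure_mono fun y hy => ?_
        simp only [Set.mem_ofPred_eq] at hy ⊢
        linarith
    _ ≤ _ := by
        rw [ENNReal.le_ofReal_iff_toReal_le (measure_ne_top _ _) (Real.exp_pos _).le]
        exact hM

lemma pi_withDensity_eq {X : Type*} [MeasurableSpace X] (Q : Measure X) [IsProbabilityMeasure Q]
    (r : X → ℝ≥0∞) (hr : Measurable r) [IsProbabilityMeasure (Q.withDensity r)] (n : ℕ) :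
    (Measure.pi fun _ : Fin n => Q.withDensity r)
      = (Measure.pi fun _ : Fin n => Q).withDensity fun x => ∏ i, r (x i) := by
  refine Measure.pi_eq fun s hs => ?_
  have hind : ∀ i, Measurable ((s i).indicator r) := fun i => hr.indicator (hs i)
  have hset : MeasurableSet (Set.univ.pi s) := MeasurableSet.univ_pi hs
  have h1 : ∀ x : Fin n → X, (Set.univ.pi s).indicator (fun x => ∏ i, r (x i)) x
      = ∏ i, (s i).indicator r (x i) := by
    intro x
    by_cases hx : x ∈ Set.univ.pi s
    · rw [Set.indicator_of_mem hx]
      exact Finset.prod_congr rfl fun i _ => (Set.indicator_of_mem (hx i trivial) r).symm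
    · rw [Set.indicator_of_notMem hx]
      simp only [Set.mem_pi, Set.mem_univ, true_implies, not_forall] at hx
      obtain ⟨i, hi⟩ := hx
      exact (Finset.prod_eq_zero (Finset.mem_univ i) (Set.indicator_of_notMem hi r)).symm
  rw [withDensity_apply _ hset, ← lintegral_indicator hset]
  simp_rw [h1]
  rw [ProbabilityTheory.lintegral_prod_eq_prod_lintegral_of_indepFun Finset.univ
    (fun i (x : Fin n → X) => (s i).indicator r (x i))
    (ProbabilityTheory.iIndepFun_pi (X := fun i => (s i).indicator r)
      fun i => (hind i).aemeasurable)
    fun i => (hind i).comp (measurable_pi_apply i)]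
  refine Finset.prod_congr rfl fun i _ => ?_
  have hmp := measurePreserving_eval (fun _ : Fin n => Q) i
  have h2 := hmp.lintegral_comp (hind i)
  simp only [Function.eval] at h2
  rw [h2, lintegral_indicator (hs i), withDensity_apply _ (hs i)]

/-- Change of measure on the set where the log-likelihood ratio is at most `c`. -/
lemma pi_inter_llr_le {X : Type*} [MeasurableSpace X] (P Q : Measure X) [IsProbabilityMeasure P]
    [IsProbabilityMeasure Q] (hPQ : P ≪ Q) (n : ℕ) (c : ℝ) (S : Set (Fin n → X))
    (hS : MeasurableSet S) :
    (Measure.pi fun _ : Fin n => P) (S ∩ {x | ∑ i, llr P Q (x i) ≤ c})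
      ≤ ENNReal.ofReal (Real.exp c) * (Measure.pi fun _ : Fin n => Q) S := by
  set r : X → ℝ≥0∞ := fun x => ENNReal.ofReal (P.rnDeriv Q x).toReal with hr
  have hrm : Measurable r := (Measure.measurable_rnDeriv P Q).ennreal_toReal.ennreal_ofReal
  have hP : P = Q.withDensity r := by
    conv_lhs => rw [← Measure.withDensity_rnDeriv_eq P Q hPQ]
    refine withDensity_congr_ae ?_
    filter_upwards [Measure.rnDeriv_lt_top P Q] with x hx
    exact (ENNReal.ofReal_toReal hx.ne).symm
  have hrexp : ∀ x, r x ≤ ENNReal.ofReal (Real.exp (llr P Q x)) :=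
    fun x => ENNReal.ofReal_le_ofReal (Real.le_exp_log _)
  have hllr := measurable_llr P Q
  have hB : MeasurableSet {x : Fin n → X | ∑ i, llr P Q (x i) ≤ c} :=
    measurableSet_le (by fun_prop) measurable_const
  have : IsProbabilityMeasure (Q.withDensity r) := hP ▸ inferInstance
  have hpi : (Measure.pi fun _ : Fin n => P)
      = (Measure.pi fun _ : Fin n => Q).withDensity fun x => ∏ i, r (x i) := by
    rw [← pi_withDensity_eq Q r hrm n, ← hP]
  rw [hpi, withDensity_apply _ (hS.inter hB)]
  calc ∫⁻ x in S ∩ {x | ∑ i, llr P Q (x i) ≤ c}, ∏ i, r (x i) ∂(Measure.pi fun _ => Q)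
      ≤ ∫⁻ _ in S ∩ {x | ∑ i, llr P Q (x i) ≤ c}, ENNReal.ofReal (Real.exp c)
          ∂(Measure.pi fun _ => Q) := by
        refine setLIntegral_mono' (hS.inter hB) fun x hx => ?_
        calc ∏ i, r (x i) ≤ ∏ i, ENNReal.ofReal (Real.exp (llr P Q (x i))) :=
              Finset.prod_le_prod' fun i _ => hrexp _
          _ = ENNReal.ofReal (Real.exp (∑ i, llr P Q (x i))) := by
              rw [Real.exp_sum, ENNReal.ofReal_prod_of_nonneg fun i _ => (Real.exp_pos _).le]
          _ ≤ _ := ENNReal.ofReal_le_ofReal (Real.exp_le_exp.2 hx.2)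
    _ = ENNReal.ofReal (Real.exp c)
          * (Measure.pi fun _ : Fin n => Q) (S ∩ {x | ∑ i, llr P Q (x i) ≤ c}) :=
        setLIntegral_const _ _
    _ ≤ _ := by gcongr; exact Set.inter_subset_left

/-- Change of measure in the second factor of a product measure. -/
lemma prod_pi_inter_llr_le {X Y : Type*} [MeasurableSpace X] [MeasurableSpace Y] (ρ : Measure Y)
    [SFinite ρ] (P Q : Measure X) [IsProbabilityMeasure P]
    [IsProbabilityMeasure Q] (hPQ : P ≪ Q) (n : ℕ) (c : ℝ) (E : Set (Y × (Fin n → X)))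
    (hE : MeasurableSet E) :
    (ρ.prod (Measure.pi fun _ : Fin n => P)) (E ∩ {p | ∑ i, llr P Q (p.2 i) ≤ c})
      ≤ ENNReal.ofReal (Real.exp c) * (ρ.prod (Measure.pi fun _ : Fin n => Q)) E := by
  have hllr := measurable_llr P Q
  have hB : MeasurableSet {p : Y × (Fin n → X) | ∑ i, llr P Q (p.2 i) ≤ c} :=
    measurableSet_le (by fun_prop) measurable_const
  rw [Measure.prod_apply (hE.inter hB), Measure.prod_apply hE,
    ← lintegral_const_mul _ (measurable_measure_prodMk_left hE)]
  refine lintegral_mono fun y => ?_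
  exact pi_inter_llr_le P Q hPQ n c (Prod.mk y ⁻¹' E) (measurable_prodMk_left hE)

/-- The weak law of large numbers on finite product spaces, one-sided version. -/
lemma tendsto_pi_sum_gt_zero {X : Type*} [MeasurableSpace X] (P : Measure X)
    [IsProbabilityMeasure P] (g : X → ℝ) (hg : Measurable g) (hgi : Integrable g P) {ε : ℝ}
    (hε : 0 < ε) :
    Tendsto (fun n : ℕ => (Measure.pi fun _ : Fin n => P)
      {x | n * ((∫ x, g x ∂P) + ε) < ∑ i, g (x i)}) atTop (𝓝 0) := by
  set μ : Measure (ℕ → X) := Measure.infinitePi fun _ => P with hμ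
  have hmp : ∀ i, MeasurePreserving (fun ω : ℕ → X => ω i) μ P := fun i =>
    measurePreserving_eval_infinitePi (fun _ => P) i
  have hind := ProbabilityTheory.iIndepFun_infinitePi (P := fun _ : ℕ => P) (X := fun _ => g)
    fun _ => hg
  have h_int0 : ∫ ω, g (ω 0) ∂μ = ∫ x, g x ∂P := by
    rw [← (hmp 0).map_eq, integral_map (hmp 0).measurable.aemeasurable hg.aestronglyMeasurable]
  have hslln := ProbabilityTheory.strong_law_ae_real (μ := μ) (fun i ω => g (ω i))
    ((hmp 0).integrable_comp_of_integrable hgi) (fun i j hij => hind.indepFun hij) (fun i =>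
      { aemeasurable_fst := (hg.comp (hmp i).measurable).aemeasurable
        aemeasurable_snd := (hg.comp (hmp 0).measurable).aemeasurable
        map_eq := by
          rw [← Function.comp_def g, ← Function.comp_def g,
            ← Measure.map_map hg (hmp i).measurable, ← Measure.map_map hg (hmp 0).measurable,
            (hmp i).map_eq, (hmp 0).map_eq] })
  have hmeas : ∀ n : ℕ, Measurable fun ω : ℕ → X => (∑ i ∈ Finset.range n, g (ω i)) / (n : ℝ) :=
    fun n => by fun_prop
  have htm := tendstoInMeasure_of_tendsto_ae (fun n => (hmeas n).aestronglyMeasurable) hslln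
  have h0 := htm (ENNReal.ofReal ε) (ENNReal.ofReal_pos.2 hε)
  refine tendsto_of_tendsto_of_tendsto_of_le_of_le' tendsto_const_nhds h0
    (Eventually.of_forall fun _ => zero_le) ?_
  filter_upwards [eventually_gt_atTop 0] with n hn
  have hn' : (0 : ℝ) < n := by exact_mod_cast hn
  have hmap : μ.map (fun ω (i : Fin n) => ω i) = Measure.pi fun _ : Fin n => P := by
    rw [Measure.map_infinitePi_infinitePi_of_inj (P := fun _ : ℕ => P) Fin.val_injective,
      Measure.infinitePi_eq_pi]
  rw [← hmap, Measure.map_apply (by fun_prop) (measurableSet_lt measurable_const (by fun_prop))]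
  refine measure_mono fun ω hω => ?_
  simp only [Set.mem_preimage, Set.mem_ofPred_eq] at hω ⊢
  rw [edist_dist, h_int0]
  refine ENNReal.ofReal_le_ofReal ?_
  rw [Finset.sum_range, Real.dist_eq]
  refine le_trans ?_ (le_abs_self _)
  have : (∫ x, g x ∂P) + ε ≤ (∑ i : Fin n, g (ω i)) / n := by
    rw [le_div_iff₀ hn']; linarith
  linarith

lemma le_expRate {n : ℕ} (hn : 0 < n) {p : ℝ≥0∞} {c : ℝ}
    (h : p ≤ ENNReal.ofReal (Real.exp (-(n * c)))) : (c : EReal) ≤ expRate n p := by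
  have hn' : (0 : ℝ) < n := by exact_mod_cast hn
  have h1 := ENNReal.log_monotone h
  rw [ENNReal.log_ofReal_of_pos (Real.exp_pos _), Real.log_exp] at h1
  have h2 : (((n : ℝ)⁻¹ : ℝ) : EReal) * ENNReal.log p
      ≤ (((n : ℝ)⁻¹ : ℝ) : EReal) * ((-(n * c) : ℝ) : EReal) :=
    mul_le_mul_of_nonneg_left h1 (by exact_mod_cast (inv_pos.2 hn').le)
  rw [← EReal.coe_mul, show (n : ℝ)⁻¹ * -(n * c) = -c by field_simp, EReal.coe_neg] at h2
  exact EReal.le_neg_of_le_neg h2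

lemma expRate_le {n : ℕ} (hn : 0 < n) {p : ℝ≥0∞} {c : ℝ}
    (h : ENNReal.ofReal (Real.exp (-(n * c))) ≤ p) : expRate n p ≤ (c : EReal) := by
  have hn' : (0 : ℝ) < n := by exact_mod_cast hn
  have h1 := ENNReal.log_monotone h
  rw [ENNReal.log_ofReal_of_pos (Real.exp_pos _), Real.log_exp] at h1
  have h2 : (((n : ℝ)⁻¹ : ℝ) : EReal) * ((-(n * c) : ℝ) : EReal)
      ≤ (((n : ℝ)⁻¹ : ℝ) : EReal) * ENNReal.log p :=
    mul_le_mul_of_nonneg_left h1 (by exact_mod_cast (inv_pos.2 hn').le)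
  rw [← EReal.coe_mul, show (n : ℝ)⁻¹ * -(n * c) = -c by field_simp, EReal.coe_neg] at h2
  exact EReal.neg_le_of_neg_le h2

/-- Chernoff's bound for the empirical mean of a bounded function. -/
lemma measure_pi_mean_ge_le {X : Type*} [MeasurableSpace X] (Q : Measure X)
    [IsProbabilityMeasure Q] (f : X → ℝ) (hf : Measurable f) (B : ℝ) (hB : ∀ x, |f x| ≤ B)
    {n : ℕ} (hn : 0 < n) (c : ℝ) :
    (Measure.pi fun _ : Fin n => Q) {x | c ≤ (n : ℝ)⁻¹ * ∑ i, f (x i)}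
      ≤ ENNReal.ofReal (Real.exp (-(n * (c - Real.log (∫ x, Real.exp (f x) ∂Q))))) := by
  have hn' : (0 : ℝ) < n := by exact_mod_cast hn
  set I := ∫ x, Real.exp (f x) ∂Q with hI
  have h_int : Integrable (fun x => Real.exp (f x)) Q :=
    integrable_of_measurable_bounded Q (C := Real.exp B) (by fun_prop) fun x => by
      rw [abs_of_pos (Real.exp_pos _)]
      exact Real.exp_le_exp.2 ((le_abs_self _).trans (hB x))
  have hIpos : 0 < I := integral_exp_pos h_int
  have hmgf : ∫ x, Real.exp (1 * ∑ i, f (x i)) ∂(Measure.pi fun _ : Fin n => Q) = I ^ n := by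
    simp_rw [one_mul, Real.exp_sum]
    rw [integral_fintype_prod_eq_pow (fun x => Real.exp (f x)), Fintype.card_fin]
  have hexpint : Integrable (fun x : Fin n → X => Real.exp (1 * ∑ i, f (x i)))
      (Measure.pi fun _ : Fin n => Q) :=
    ProbabilityTheory.integrable_exp_mul_of_mem_Icc (a := -(∑ _i : Fin n, B))
      (b := ∑ _i : Fin n, B) (Measurable.aemeasurable (by fun_prop))
      (Eventually.of_forall fun x => abs_le.1 <|
        (Finset.abs_sum_le_sum_abs _ _).trans (Finset.sum_le_sum fun i _ => hB _))
  have h := ProbabilityTheory.measure_ge_le_exp_mul_mgf (μ := Measure.pi fun _ : Fin n => Q)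
    (X := fun x : Fin n → X => ∑ i, f (x i)) (t := 1) (n * c) zero_le_one hexpint
  unfold ProbabilityTheory.mgf at h
  rw [hmgf] at h
  have hset : {x : Fin n → X | c ≤ (n : ℝ)⁻¹ * ∑ i, f (x i)} = {x | n * c ≤ ∑ i, f (x i)} := by
    ext x
    simp only [Set.mem_ofPred_eq]
    rw [le_inv_mul_iff₀ hn']
  rw [hset, ENNReal.le_ofReal_iff_toReal_le (measure_ne_top _ _) (Real.exp_pos _).le]
  refine h.trans (le_of_eq ?_)
  rw [← Real.exp_log (pow_pos hIpos n), ← Real.exp_add, Real.log_pow]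
  congr 1; ring

/-- One half of the Donsker-Varadhan formula, with bounded continuous test functions. -/
lemma exists_boundedContinuous_donsker_varadhan {X : Type*} [MeasurableSpace X]
    [TopologicalSpace X] [PolishSpace X] [BorelSpace X]
    (P Q : Measure X) [IsProbabilityMeasure P] [IsProbabilityMeasure Q] (hPQ : P ≪ Q)
    (h_int : Integrable (llr P Q) P) {ε : ℝ} (hε : 0 < ε) :
    ∃ f : BoundedContinuousFunction X ℝ, (∫ x, llr P Q x ∂P) - 4 * ε
      ≤ (∫ x, f x ∂P) - Real.log (∫ x, Real.exp (f x) ∂Q) := by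
  set r : X → ℝ := fun x => (P.rnDeriv Q x).toReal with hr
  have hrm : Measurable r := (Measure.measurable_rnDeriv P Q).ennreal_toReal
  set g : ℕ → X → ℝ := fun N x => Real.log (max (Real.exp (-N)) (min (Real.exp N) (r x))) with hg
  have hgm : ∀ N, Measurable (g N) := fun N => by fun_prop
  have hclip : ∀ N x, 0 < max (Real.exp (-(N : ℕ))) (min (Real.exp N) (r x)) := fun N x =>
    lt_max_of_lt_left (Real.exp_pos _)
  have hgB : ∀ N x, |g N x| ≤ N := by
    intro N x
    rw [abs_le]
    constructor
    · rw [Real.le_log_iff_exp_le (hclip N x)]; exact le_max_left _ _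
    · rw [Real.log_le_iff_le_exp (hclip N x)]
      exact max_le (Real.exp_le_exp.2 (by linarith [N.cast_nonneg (α := ℝ)])) (min_le_left _ _)
  have hrpos : ∀ᵐ x ∂P, 0 < r x := by
    filter_upwards [Measure.rnDeriv_pos hPQ, hPQ.ae_le (Measure.rnDeriv_lt_top P Q)] with x h1 h2
    exact ENNReal.toReal_pos h1.ne' h2.ne
  have hgeq : ∀ (N : ℕ) x, 0 < r x → g N x = max (-(N : ℝ)) (min N (llr P Q x)) := by
    intro N x hx
    have hx' : r x = Real.exp (llr P Q x) := (Real.exp_log hx).symm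
    simp only [hg]
    rw [hx', ← Real.exp_monotone.map_min, ← Real.exp_monotone.map_max, Real.log_exp]
  have hlim : Tendsto (fun N => ∫ x, g N x ∂P) atTop (𝓝 (∫ x, llr P Q x ∂P)) := by
    refine tendsto_integral_of_dominated_convergence (fun x => |llr P Q x|)
      (fun N => (hgm N).aestronglyMeasurable) h_int.abs ?_ ?_
    · intro N
      filter_upwards [hrpos] with x hx
      rw [hgeq N x hx, Real.norm_eq_abs, abs_le]
      have hN := N.cast_nonneg (α := ℝ)
      constructor
      · exact le_max_of_le_right (le_min (by linarith [abs_nonneg (llr P Q x)])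
          (neg_abs_le _))
      · exact max_le (by linarith [abs_nonneg (llr P Q x)])
          ((min_le_right _ _).trans (le_abs_self _))
    · filter_upwards [hrpos] with x hx
      obtain ⟨M, hM⟩ := exists_nat_ge |llr P Q x|
      refine tendsto_const_nhds.congr' ?_
      filter_upwards [eventually_ge_atTop M] with N hN
      have hN' : |llr P Q x| ≤ N := hM.trans (by exact_mod_cast hN)
      rw [hgeq N x hx, min_eq_right (le_of_abs_le hN'), max_eq_right (neg_le_of_abs_le hN')]
  have hexp0 : Tendsto (fun N : ℕ => Real.exp (-(N : ℝ))) atTop (𝓝 0) :=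
    Real.tendsto_exp_neg_atTop_nhds_zero.comp tendsto_natCast_atTop_atTop
  obtain ⟨N, hN1, hN2⟩ := ((hlim.eventually_const_lt (show (∫ x, llr P Q x ∂P) - ε
    < ∫ x, llr P Q x ∂P by linarith)).and (hexp0.eventually_le_const hε)).exists
  have hrint : Integrable r Q := Measure.integrable_toReal_rnDeriv
  have hr1 : ∫ x, r x ∂Q = 1 := by
    rw [Measure.integral_toReal_rnDeriv hPQ]; simp
  have hbound : ∀ (ρ : Measure X) [IsProbabilityMeasure ρ] (φ : X → ℝ), Measurable φ →
      (∀ x, |φ x| ≤ N) → Integrable φ ρ ∧ Integrable (fun x => Real.exp (φ x)) ρ := by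
    intro ρ _ φ hφ hb
    refine ⟨integrable_of_measurable_bounded ρ hφ hb,
      integrable_of_measurable_bounded ρ (C := Real.exp N) (by fun_prop) fun x => ?_⟩
    rw [abs_of_pos (Real.exp_pos _)]
    exact Real.exp_le_exp.2 ((le_abs_self _).trans (hb x))
  have hgexp : ∫ x, Real.exp (g N x) ∂Q ≤ 1 + ε := by
    calc ∫ x, Real.exp (g N x) ∂Q ≤ ∫ x, (r x + Real.exp (-N)) ∂Q := by
          refine integral_mono (hbound Q _ (hgm N) (hgB N)).2 (hrint.add (integrable_const _))
            fun x => ?_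
          simp only [hg]
          rw [Real.exp_log (hclip N x)]
          have : 0 ≤ r x := ENNReal.toReal_nonneg
          exact max_le (by linarith) ((min_le_right _ _).trans (by linarith [Real.exp_pos (-N)]))
      _ = 1 + Real.exp (-N) := by rw [integral_add hrint (integrable_const _), hr1]; simp
      _ ≤ 1 + ε := by linarith
  set η := ε * Real.exp (-N) with hη
  have hηpos : 0 < η := mul_pos hε (Real.exp_pos _)
  have hηle : η ≤ ε := by
    have : Real.exp (-(N : ℝ)) ≤ 1 := Real.exp_le_one_iff.2 (by simp)
    calc η ≤ ε * 1 := mul_le_mul_of_nonneg_left this hε.le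
      _ = ε := mul_one _
  have hgi : Integrable (g N) (P + Q) := integrable_of_measurable_bounded _ (hgm N) (hgB N)
  obtain ⟨h0, hh0, hh0i⟩ := hgi.exists_boundedContinuous_integral_sub_le hηpos
  set h : BoundedContinuousFunction X ℝ := BoundedContinuousFunction.ofNormedAddCommGroup
    (fun x => max (-(N : ℝ)) (min (N : ℝ) (h0 x))) (by fun_prop) N (fun x => by
      rw [Real.norm_eq_abs, abs_le]
      exact ⟨le_max_left _ _, max_le (by linarith [N.cast_nonneg (α := ℝ)]) (min_le_left _ _)⟩)
    with hh
  have hhx : ∀ x, h x = max (-(N : ℝ)) (min (N : ℝ) (h0 x)) := fun x => rfl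
  have hhB : ∀ x, |h x| ≤ N := by
    intro x
    rw [hhx, abs_le]
    exact ⟨le_max_left _ _, max_le (by linarith [N.cast_nonneg (α := ℝ)]) (min_le_left _ _)⟩
  have hhm : Measurable h := h.continuous.measurable
  have hclose : ∀ x, |g N x - h x| ≤ ‖g N x - h0 x‖ := by
    intro x
    have hgx := abs_le.1 (hgB N x)
    have : g N x = max (-(N : ℝ)) (min N (g N x)) := by
      rw [min_eq_right hgx.2, max_eq_right hgx.1]
    rw [hhx, Real.norm_eq_abs]
    conv_lhs => rw [this]
    calc |max (-(N : ℝ)) (min N (g N x)) - max (-(N : ℝ)) (min (N : ℝ) (h0 x))|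
        ≤ |min (N : ℝ) (g N x) - min (N : ℝ) (h0 x)| := by
          simpa [max_comm] using
            abs_max_sub_max_le_abs (min (N : ℝ) (g N x)) (min (N : ℝ) (h0 x)) (-N)
      _ ≤ |g N x - h0 x| := by
          simpa using abs_min_sub_min_le_max (N : ℝ) (g N x) (N : ℝ) (h0 x)
  have hdi : Integrable (fun x => |g N x - h x|) (P + Q) :=
    (hgi.sub (integrable_of_measurable_bounded _ hhm hhB)).abs
  have hd : ∫ x, |g N x - h x| ∂(P + Q) ≤ η :=
    (integral_mono hdi (hgi.sub hh0i).norm hclose).trans hh0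
  have hdPi : Integrable (fun x => |g N x - h x|) P := hdi.left_of_add_measure
  have hdQi : Integrable (fun x => |g N x - h x|) Q := hdi.right_of_add_measure
  rw [integral_add_measure hdPi hdQi] at hd
  have hdP0 : 0 ≤ ∫ x, |g N x - h x| ∂P := integral_nonneg fun x => abs_nonneg _
  have hdQ0 : 0 ≤ ∫ x, |g N x - h x| ∂Q := integral_nonneg fun x => abs_nonneg _
  have hPle : (∫ x, g N x ∂P) - ε ≤ ∫ x, h x ∂P := by
    have h1 : (∫ x, g N x ∂P) - ∫ x, h x ∂P ≤ ∫ x, |g N x - h x| ∂P := by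
      rw [← integral_sub (hbound P _ (hgm N) (hgB N)).1 (hbound P _ hhm hhB).1]
      exact integral_mono ((hbound P _ (hgm N) (hgB N)).1.sub (hbound P _ hhm hhB).1) hdPi
        fun x => le_abs_self _
    linarith
  have hQle : ∫ x, Real.exp (h x) ∂Q ≤ 1 + 2 * ε := by
    have h1 : ∫ x, Real.exp (h x) ∂Q ≤ ∫ x, (Real.exp (g N x) + Real.exp N * |g N x - h x|) ∂Q := by
      refine integral_mono (hbound Q _ hhm hhB).2
        ((hbound Q _ (hgm N) (hgB N)).2.add (hdQi.const_mul _)) fun x => ?_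
      have h2 : Real.exp (g N x) = Real.exp (h x) * Real.exp (g N x - h x) := by
        rw [← Real.exp_add]; congr 1; ring
      have h3 := Real.add_one_le_exp (g N x - h x)
      have h4 : Real.exp (h x) * (h x - g N x) ≤ Real.exp N * |g N x - h x| := by
        calc Real.exp (h x) * (h x - g N x) ≤ Real.exp (h x) * |g N x - h x| := by
              gcongr
              rw [abs_sub_comm]; exact le_abs_self _
          _ ≤ _ := by
              gcongr
              exact (le_abs_self _).trans (hhB x)
      have h5 := mul_le_mul_of_nonneg_left h3 (Real.exp_pos (h x)).le
      simp only
      rw [h2]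
      linarith
    rw [integral_add (hbound Q _ (hgm N) (hgB N)).2 (hdQi.const_mul _), integral_const_mul] at h1
    have h6 : Real.exp N * ∫ x, |g N x - h x| ∂Q ≤ ε := by
      calc Real.exp N * ∫ x, |g N x - h x| ∂Q ≤ Real.exp N * η := by gcongr; linarith
        _ = ε := by
          rw [hη, mul_left_comm, ← Real.exp_add]; simp
    linarith
  have hlog : Real.log (∫ x, Real.exp (h x) ∂Q) ≤ 2 * ε := by
    have := Real.log_le_sub_one_of_pos (integral_exp_pos (hbound Q _ hhm hhB).2)
    linarith
  exact ⟨h, by linarith⟩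

lemma measurable_mmd_empMeas_empMeas {X : Type*} [MeasurableSpace X] [Nonempty X]
    [MeasurableSingletonClass X] (k : X → X → ℝ)
    (hkm : Measurable fun p : X × X => k p.1 p.2) {m n : ℕ} (hm : 0 < m) (hn : 0 < n) :
    Measurable fun p : (Fin m → X) × (Fin n → X) =>
      mmd k (empMeas m p.1 : Measure X) (empMeas n p.2 : Measure X) := by
  unfold mmd mmdSq
  simp only [integral_empMeas hm, integral_empMeas hn]
  have h : ∀ a b : (Fin m → X) × (Fin n → X) → X, Measurable a → Measurable b →
      Measurable fun p => k (a p) (b p) := fun a b ha hb =>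
    hkm.comp (f := fun p => (a p, b p)) (ha.prodMk hb)
  have h1 : ∀ i j, Measurable fun p : (Fin m → X) × (Fin n → X) => k (p.1 i) (p.1 j) :=
    fun i j => h _ _ (by fun_prop) (by fun_prop)
  have h2 : ∀ i j, Measurable fun p : (Fin m → X) × (Fin n → X) => k (p.2 i) (p.2 j) :=
    fun i j => h _ _ (by fun_prop) (by fun_prop)
  have h3 : ∀ i j, Measurable fun p : (Fin m → X) × (Fin n → X) => k (p.1 i) (p.2 j) :=
    fun i j => h _ _ (by fun_prop) (by fun_prop)
  fun_prop

lemma measure_prod_le_add_of_subset {Y Z : Type*} [MeasurableSpace Y] [MeasurableSpace Z]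
    (ρ : Measure Y) (σ : Measure Z) [IsProbabilityMeasure ρ] [IsProbabilityMeasure σ]
    {E : Set (Y × Z)} {A : Set Y} {B : Set Z} (h : ∀ p ∈ E, p.1 ∈ A ∨ p.2 ∈ B) :
    (ρ.prod σ) E ≤ ρ A + σ B := by
  calc (ρ.prod σ) E ≤ (ρ.prod σ) (A ×ˢ Set.univ ∪ Set.univ ×ˢ B) :=
        measure_mono fun p hp => (h p hp).imp (fun h => ⟨h, trivial⟩) fun h => ⟨trivial, h⟩
    _ ≤ _ := measure_union_le _ _
    _ = ρ A + σ B := by simp [Measure.prod_prod]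

lemma mmd_test_level {X : Type*} [MeasurableSpace X] [Nonempty X]
    [MeasurableSingletonClass X] (k : X → X → ℝ)
    (hkm : Measurable fun p : X × X => k p.1 p.2) (hk_symm : ∀ x y, k x y = k y x)
    (hk_psd : ∀ (N : ℕ) (z : Fin N → X) (c : Fin N → ℝ),
      0 ≤ ∑ i, ∑ j, c i * c j * k (z i) (z j))
    (K : ℝ) (hK : 0 < K) (hk_bdd : ∀ x y, k x y ∈ Set.Icc (0 : ℝ) K)
    (h_tri : ∀ R S T : ProbabilityMeasure X,
      mmd k (R : Measure X) (T : Measure X)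
        ≤ mmd k (R : Measure X) (S : Measure X) + mmd k (S : Measure X) (T : Measure X))
    (P : ProbabilityMeasure X) {α : ℝ} (hα0 : 0 < α) (hα1 : α < 1) {m n : ℕ} (hm : 0 < m)
    (hn : 0 < n) :
    (Measure.pi (fun _ : Fin m => (P : Measure X))).prod
        (Measure.pi (fun _ : Fin n => (P : Measure X)))
        {p | (Real.sqrt (K / m) + Real.sqrt (K / n)) * (2 + Real.sqrt (2 * Real.log (2 / α)))
          < mmd k (empMeas m p.1 : Measure X) (empMeas n p.2 : Measure X)}
      ≤ ENNReal.ofReal α := by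
  have hkb : ∀ x y, |k x y| ≤ K := fun x y =>
    (abs_of_nonneg (hk_bdd x y).1).le.trans (hk_bdd x y).2
  have hlog : 0 < Real.log (2 / α) := Real.log_pos (by rw [one_lt_div hα0]; linarith)
  set s := Real.sqrt (2 * Real.log (2 / α)) with hs
  have hs0 : 0 ≤ s := Real.sqrt_nonneg _
  have hs2 : s ^ 2 = 2 * Real.log (2 / α) := Real.sq_sqrt (by positivity)
  have htail : ∀ l : ℕ, 0 < l → (Measure.pi fun _ : Fin l => (P : Measure X))
      {y | Real.sqrt (K / l) * (2 + s) ≤ mmd k (empMeas l y : Measure X) (P : Measure X)}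
        ≤ ENNReal.ofReal (α / 2) := by
    intro l hl
    have hl' : (0 : ℝ) < l := by exact_mod_cast hl
    have h := measure_mmd_empMeas_ge_le k hkm hk_symm hk_psd K hK hk_bdd h_tri P hl
      (ε := Real.sqrt (K / l) * (1 + s)) (by positivity)
    rw [show Real.sqrt (K / l) + Real.sqrt (K / l) * (1 + s) = Real.sqrt (K / l) * (2 + s) by
      ring] at h
    refine h.trans (ENNReal.ofReal_le_ofReal ?_)
    have h1 : (l : ℝ) * (Real.sqrt (K / l) * (1 + s)) ^ 2 / (2 * K) = (1 + s) ^ 2 / 2 := by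
      rw [mul_pow, Real.sq_sqrt (by positivity)]
      field_simp
    rw [h1, ← Real.exp_log (show 0 < α / 2 by positivity), Real.exp_le_exp,
      ← inv_div 2 α, Real.log_inv]
    nlinarith
  calc _ ≤ _ := measure_prod_le_add_of_subset _ _
        (A := {y | Real.sqrt (K / m) * (2 + s) ≤ mmd k (empMeas m y : Measure X) (P : Measure X)})
        (B := {y | Real.sqrt (K / n) * (2 + s) ≤ mmd k (empMeas n y : Measure X) (P : Measure X)})
        ?_
    _ ≤ ENNReal.ofReal (α / 2) + ENNReal.ofReal (α / 2) := add_le_add (htail m hm) (htail n hn)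
    _ = ENNReal.ofReal α := by
        rw [← ENNReal.ofReal_add (by positivity) (by positivity)]; congr 1; ring
  rintro ⟨y, x⟩ hp
  simp only [Set.mem_ofPred_eq] at hp ⊢
  by_contra! hcon
  have h1 := h_tri (empMeas m y) P (empMeas n x)
  have h2 : mmd k (P : Measure X) (empMeas n x : Measure X)
      = mmd k (empMeas n x : Measure X) (P : Measure X) := by
    unfold mmd; rw [mmdSq_comm k hkm hk_symm K hkb]
  rw [h2] at h1
  linarith [hcon.1, hcon.2]

lemma tendsto_exp_neg_natCast_mul {ε : ℝ} (hε : 0 < ε) :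
    Tendsto (fun n : ℕ => Real.exp (-(n * ε))) atTop (𝓝 0) :=
  Real.tendsto_exp_neg_atTop_nhds_zero.comp
    (tendsto_natCast_atTop_atTop.atTop_mul_const hε)

/-- The type-II error probability is at least `exp (-n (D + ε))` for large `n`. -/
lemma eventually_exp_le_typeII {X : Type*} [MeasurableSpace X] [Nonempty X]
    [MeasurableSingletonClass X] (k : X → X → ℝ)
    (hkm : Measurable fun p : X × X => k p.1 p.2) (P Q : ProbabilityMeasure X)
    (hPQ : (P : Measure X) ≪ Q) (h_int : Integrable (llr (P : Measure X) Q) (P : Measure X))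
    {α : ℝ} (hα1 : α < 1) (hα0 : 0 < α)
    (m : ℕ → ℕ) (hm : ∀ᶠ n in atTop, 0 < m n) (γ : ℕ → ℕ → ℝ)
    (hlevel : ∀ m' n : ℕ, 0 < m' → 0 < n →
      (Measure.pi (fun _ : Fin m' => (P : Measure X))).prod
          (Measure.pi (fun _ : Fin n => (P : Measure X)))
          {p : (Fin m' → X) × (Fin n → X) |
            γ m' n < mmd k (empMeas m' p.1 : Measure X) (empMeas n p.2 : Measure X)}
        ≤ ENNReal.ofReal α) {ε : ℝ} (hε : 0 < ε) :
    ∀ᶠ n : ℕ in atTop, ENNReal.ofReal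
        (Real.exp (-(n * ((∫ x, llr (P : Measure X) Q x ∂(P : Measure X)) + 2 * ε))))
      ≤ (Measure.pi (fun _ : Fin (m n) => (P : Measure X))).prod
          (Measure.pi (fun _ : Fin n => (Q : Measure X)))
          {p | mmd k (empMeas (m n) p.1 : Measure X) (empMeas n p.2 : Measure X) ≤ γ (m n) n} := by
  set D := ∫ x, llr (P : Measure X) Q x ∂(P : Measure X) with hD
  have hβ : 0 < (1 - α) / 2 := by linarith
  filter_upwards [hm, eventually_gt_atTop 0, (tendsto_exp_neg_natCast_mul hε).eventually_le_const hβ,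
    (tendsto_pi_sum_gt_zero (P : Measure X) _ (measurable_llr (P : Measure X) Q) h_int
      hε).eventually_le_const (ENNReal.ofReal_pos.2 hβ)] with n hmn hn hexp hlln
  set ρ := Measure.pi (fun _ : Fin (m n) => (P : Measure X)) with hρ
  set σ := Measure.pi (fun _ : Fin n => (P : Measure X)) with hσ
  set E : Set ((Fin (m n) → X) × (Fin n → X)) :=
    {p | mmd k (empMeas (m n) p.1 : Measure X) (empMeas n p.2 : Measure X) ≤ γ (m n) n} with hE
  have hEm : MeasurableSet E :=
    measurableSet_le (measurable_mmd_empMeas_empMeas k hkm hmn hn) measurable_const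
  set B : Set ((Fin (m n) → X) × (Fin n → X)) :=
    {p | ∑ i, llr (P : Measure X) Q (p.2 i) ≤ n * (D + ε)} with hB
  have hEc : (ρ.prod σ) Eᶜ ≤ ENNReal.ofReal α := by
    refine le_trans (measure_mono fun p hp => ?_) (hlevel (m n) n hmn hn)
    simpa only [hE, Set.mem_compl_iff, Set.mem_ofPred_eq, not_le] using hp
  have hBc : (ρ.prod σ) Bᶜ ≤ ENNReal.ofReal ((1 - α) / 2) := by
    have := measure_prod_le_add_of_subset ρ σ (E := Bᶜ) (A := ∅)
      (B := {x | n * (D + ε) < ∑ i, llr (P : Measure X) Q (x i)})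
      fun p hp => Or.inr (by
        simpa only [hB, Set.mem_compl_iff, Set.mem_ofPred_eq, not_le] using hp)
    rw [measure_empty, zero_add] at this
    exact this.trans hlln
  have hcov : (1 : ℝ≥0∞) ≤ (ρ.prod σ) (E ∩ B) + ((ρ.prod σ) Eᶜ + (ρ.prod σ) Bᶜ) := by
    rw [← measure_univ (μ := ρ.prod σ), ← Set.union_compl_self (E ∩ B), Set.compl_inter]
    exact (measure_union_le _ _).trans (by gcongr; exact measure_union_le _ _)
  have hEB : ENNReal.ofReal ((1 - α) / 2) ≤ (ρ.prod σ) (E ∩ B) := by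
    by_contra! hlt
    have h1 : (ρ.prod σ) (E ∩ B) + ((ρ.prod σ) Eᶜ + (ρ.prod σ) Bᶜ) < 1 := by
      calc _ < ENNReal.ofReal ((1 - α) / 2)
            + (ENNReal.ofReal α + ENNReal.ofReal ((1 - α) / 2)) :=
            ENNReal.add_lt_add_of_lt_of_le (by finiteness) hlt (add_le_add hEc hBc)
        _ = 1 := by
            rw [← ENNReal.ofReal_add hα0.le hβ.le, ← ENNReal.ofReal_add hβ.le (by linarith),
              ← ENNReal.ofReal_one]
            congr 1; ring
    exact absurd hcov (not_le.2 h1)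
  have hchange := prod_pi_inter_llr_le ρ (P : Measure X) (Q : Measure X) hPQ n (n * (D + ε)) E hEm
  have h2 := hEB.trans hchange
  calc ENNReal.ofReal (Real.exp (-(n * (D + 2 * ε))))
      = ENNReal.ofReal (Real.exp (-(n * (D + ε)))) * ENNReal.ofReal (Real.exp (-(n * ε))) := by
        rw [← ENNReal.ofReal_mul (Real.exp_pos _).le, ← Real.exp_add]; congr 2; ring
    _ ≤ ENNReal.ofReal (Real.exp (-(n * (D + ε)))) * ENNReal.ofReal ((1 - α) / 2) := by gcongr
    _ ≤ ENNReal.ofReal (Real.exp (-(n * (D + ε)))) * (ENNReal.ofReal (Real.exp (n * (D + ε))) *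
          (ρ.prod (Measure.pi fun _ : Fin n => (Q : Measure X))) E) := by gcongr
    _ = _ := by
        rw [← mul_assoc, ← ENNReal.ofReal_mul (Real.exp_pos _).le, ← Real.exp_add, neg_add_cancel,
          Real.exp_zero, ENNReal.ofReal_one, one_mul]

/-- The type-II error probability is at most `exp (-n (D - ε))` for large `n`. -/
lemma eventually_typeII_le_exp {X : Type*} [MeasurableSpace X] [TopologicalSpace X]
    [PolishSpace X] [BorelSpace X] [Nonempty X] (k : X → X → ℝ)
    (hkm : Measurable fun p : X × X => k p.1 p.2) (hk_symm : ∀ x y, k x y = k y x)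
    (hk_psd : ∀ (N : ℕ) (z : Fin N → X) (c : Fin N → ℝ),
      0 ≤ ∑ i, ∑ j, c i * c j * k (z i) (z j))
    (K : ℝ) (hK : 0 < K) (hk_bdd : ∀ x y, k x y ∈ Set.Icc (0 : ℝ) K)
    (h_tri : ∀ R S T : ProbabilityMeasure X,
      mmd k (R : Measure X) (T : Measure X)
        ≤ mmd k (R : Measure X) (S : Measure X) + mmd k (S : Measure X) (T : Measure X))
    (h_metrize : ∀ s : Set (ProbabilityMeasure X),
      IsOpen s ↔ ∀ R ∈ s, ∃ ε > 0,
        ∀ S : ProbabilityMeasure X, mmd k (S : Measure X) (R : Measure X) < ε → S ∈ s)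
    (P Q : ProbabilityMeasure X) (hPQ : (P : Measure X) ≪ Q)
    (h_int : Integrable (llr (P : Measure X) Q) (P : Measure X))
    (m : ℕ → ℕ) (hmn : Tendsto (fun n : ℕ => (m n : ℝ) / n) atTop atTop)
    (hm : Tendsto (fun n : ℕ => (m n : ℝ)) atTop atTop)
    (γ : ℕ → ℕ → ℝ) (hγ : Tendsto (fun n => γ (m n) n) atTop (𝓝 0)) {ε : ℝ} (hε : 0 < ε) :
    ∀ᶠ n : ℕ in atTop, (Measure.pi (fun _ : Fin (m n) => (P : Measure X))).prod
          (Measure.pi (fun _ : Fin n => (Q : Measure X)))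
          {p | mmd k (empMeas (m n) p.1 : Measure X) (empMeas n p.2 : Measure X) ≤ γ (m n) n}
      ≤ ENNReal.ofReal
        (Real.exp (-(n * ((∫ x, llr (P : Measure X) Q x ∂(P : Measure X)) - 6 * ε)))) := by
  have hkb : ∀ x y, |k x y| ≤ K := fun x y =>
    (abs_of_nonneg (hk_bdd x y).1).le.trans (hk_bdd x y).2
  set D := ∫ x, llr (P : Measure X) Q x ∂(P : Measure X) with hD
  obtain ⟨f, hf⟩ := exists_boundedContinuous_donsker_varadhan (P : Measure X) (Q : Measure X) hPQ
    h_int hε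
  set c := (∫ x, f x ∂(P : Measure X)) - ε with hc
  have hopen : IsOpen {R : ProbabilityMeasure X | c < ∫ x, f x ∂(R : Measure X)} :=
    isOpen_lt continuous_const
      (ProbabilityMeasure.continuous_integral_boundedContinuousFunction f)
  obtain ⟨δ₀, hδ₀, hball⟩ := (h_metrize _).1 hopen P (show c < _ by linarith)
  set δ := δ₀ / 3 with hδ
  have hδpos : 0 < δ := by positivity
  have hKm : Tendsto (fun n => Real.sqrt (K / m n)) atTop (𝓝 0) := by
    rw [← Real.sqrt_zero]
    exact (hm.const_div_atTop K).sqrt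
  filter_upwards [eventually_gt_atTop 0, hm.eventually_gt_atTop 0,
    hmn.eventually_ge_atTop (2 * K * D / δ ^ 2), hKm.eventually_le_const hδpos,
    hγ.eventually_le_const hδpos,
    (tendsto_exp_neg_natCast_mul hε).eventually_le_const (show (0 : ℝ) < 1 / 2 by norm_num)]
    with n hn hmpos hratio hKδ hγδ hexp
  have hn' : (0 : ℝ) < n := by exact_mod_cast hn
  have hmpos' : 0 < m n := by exact_mod_cast hmpos
  have h1 := measure_mmd_empMeas_ge_le k hkm hk_symm hk_psd K hK hk_bdd h_tri P hmpos' hδpos.le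
  have h2 := measure_pi_mean_ge_le (Q : Measure X) f f.continuous.measurable ‖f‖
    (fun x => f.norm_coe_le_norm x) hn c
  have h1' : Real.exp (-(m n * δ ^ 2 / (2 * K))) ≤ Real.exp (-(n * (D - 5 * ε))) := by
    rw [Real.exp_le_exp, neg_le_neg_iff]
    rw [div_le_div_iff₀ (by positivity) hn'] at hratio
    rw [le_div_iff₀ (by positivity)]
    nlinarith [mul_pos (mul_pos hn' hε) hK]
  have h2' : Real.exp (-(n * (c - Real.log (∫ x, Real.exp (f x) ∂(Q : Measure X)))))
      ≤ Real.exp (-(n * (D - 5 * ε))) := by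
    rw [Real.exp_le_exp, neg_le_neg_iff]
    exact mul_le_mul_of_nonneg_left (by linarith) hn'.le
  have hsub : ∀ p ∈ {p : (Fin (m n) → X) × (Fin n → X) |
      mmd k (empMeas (m n) p.1 : Measure X) (empMeas n p.2 : Measure X) ≤ γ (m n) n},
      p.1 ∈ {y | Real.sqrt (K / m n) + δ ≤ mmd k (empMeas (m n) y : Measure X) (P : Measure X)} ∨
        p.2 ∈ {x | c ≤ (n : ℝ)⁻¹ * ∑ i, f (x i)} := by
    rintro ⟨y, x⟩ hp
    simp only [Set.mem_ofPred_eq] at hp ⊢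
    by_contra! hcon
    have htri := h_tri (empMeas n x) (empMeas (m n) y) P
    have hcomm : mmd k (empMeas n x : Measure X) (empMeas (m n) y : Measure X)
        = mmd k (empMeas (m n) y : Measure X) (empMeas n x : Measure X) := by
      unfold mmd; rw [mmdSq_comm k hkm hk_symm K hkb]
    have hmem := hball (empMeas n x) (by linarith [hcon.1])
    rw [Set.mem_ofPred_eq, integral_empMeas hn] at hmem
    linarith [hcon.2]
  have hfactor : Real.exp (-(n * (D - 5 * ε)))
      = Real.exp (-(n * (D - 6 * ε))) * Real.exp (-(n * ε)) := by
    rw [← Real.exp_add]; congr 1; ring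
  have hfinal : Real.exp (-(n * (D - 5 * ε))) + Real.exp (-(n * (D - 5 * ε)))
      ≤ Real.exp (-(n * (D - 6 * ε))) := by
    rw [hfactor]
    nlinarith [Real.exp_pos (-(n * (D - 6 * ε)))]
  refine (measure_prod_le_add_of_subset _ _ hsub).trans ?_
  refine (add_le_add (h1.trans (ENNReal.ofReal_le_ofReal h1'))
    (h2.trans (ENNReal.ofReal_le_ofReal h2'))).trans ?_
  rw [← ENNReal.ofReal_add (Real.exp_pos _).le (Real.exp_pos _).le]
  exact ENNReal.ofReal_le_ofReal hfinal

/-- The quadratic-time MMD two-sample test `d_k(P̂_m, Q̂_n) ≤ γ_{m,n}` with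
`γ_{m,n} = (sqrt(K/m) + sqrt(K/n))(2 + sqrt(2 log(2/α)))` and `m = m(n)` samples drawn from
`P` with `m(n)/n → ∞`: under `H₀ : Q = P` it is level `α` for all sample sizes, and under
`H₁` with `0 < D(P‖Q) < ∞` its type-II error exponent (in `n`) equals `D(P‖Q)`. -/
theorem mmd_two_sample_test_optimal {X : Type*} [MeasurableSpace X] [TopologicalSpace X]
    [PolishSpace X] [LocallyCompactSpace X] [T2Space X] [BorelSpace X] [Nonempty X]
    (k : X → X → ℝ) (hk_cont : Continuous fun p : X × X => k p.1 p.2)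
    (hk_symm : ∀ x y, k x y = k y x)
    (hk_psd : ∀ (N : ℕ) (z : Fin N → X) (c : Fin N → ℝ),
      0 ≤ ∑ i, ∑ j, c i * c j * k (z i) (z j))
    (K : ℝ) (hK : 0 < K) (hk_bdd : ∀ x y, k x y ∈ Set.Icc (0 : ℝ) K)
    (h_sep : ∀ R S : ProbabilityMeasure X,
      mmd k (R : Measure X) (S : Measure X) = 0 ↔ R = S)
    (h_tri : ∀ R S T : ProbabilityMeasure X,
      mmd k (R : Measure X) (T : Measure X)
        ≤ mmd k (R : Measure X) (S : Measure X) + mmd k (S : Measure X) (T : Measure X))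
    (h_metrize : ∀ s : Set (ProbabilityMeasure X),
      IsOpen s ↔ ∀ R ∈ s, ∃ ε > 0,
        ∀ S : ProbabilityMeasure X, mmd k (S : Measure X) (R : Measure X) < ε → S ∈ s)
    (P Q : ProbabilityMeasure X) {α : ℝ} (hα0 : 0 < α) (hα1 : α < 1)
    (m : ℕ → ℕ) (hmn : Tendsto (fun n : ℕ => (m n : ℝ) / n) atTop atTop)
    (γ : ℕ → ℕ → ℝ)
    (hγ : ∀ m' n : ℕ, γ m' n = (Real.sqrt (K / m') + Real.sqrt (K / n)) *
      (2 + Real.sqrt (2 * Real.log (2 / α)))) :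
    (Q = P → ∀ m' n : ℕ, 0 < m' → 0 < n →
      (Measure.pi (fun _ : Fin m' => (P : Measure X))).prod
          (Measure.pi (fun _ : Fin n => (P : Measure X)))
          {p : (Fin m' → X) × (Fin n → X) |
            γ m' n < mmd k (empMeas m' p.1 : Measure X) (empMeas n p.2 : Measure X)}
        ≤ ENNReal.ofReal α)
    ∧ (0 < klDiv (P : Measure X) (Q : Measure X) →
        klDiv (P : Measure X) (Q : Measure X) < ⊤ →
        liminf (fun n : ℕ => expRate n
            ((Measure.pi (fun _ : Fin (m n) => (P : Measure X))).prod
              (Measure.pi (fun _ : Fin n => (Q : Measure X)))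
              {p : (Fin (m n) → X) × (Fin n → X) |
                mmd k (empMeas (m n) p.1 : Measure X) (empMeas n p.2 : Measure X)
                  ≤ γ (m n) n})) atTop
          = ((klDiv (P : Measure X) (Q : Measure X) : ℝ≥0∞) : EReal)) := by
  have hkm : Measurable fun p : X × X => k p.1 p.2 := hk_cont.measurable
  have hlevel : ∀ m' n : ℕ, 0 < m' → 0 < n →
      (Measure.pi (fun _ : Fin m' => (P : Measure X))).prod
          (Measure.pi (fun _ : Fin n => (P : Measure X)))
          {p : (Fin m' → X) × (Fin n → X) |
            γ m' n < mmd k (empMeas m' p.1 : Measure X) (empMeas n p.2 : Measure X)}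
        ≤ ENNReal.ofReal α := by
    intro m' n hm' hn
    rw [hγ]
    exact mmd_test_level k hkm hk_symm hk_psd K hK hk_bdd h_tri P hα0 hα1 hm' hn
  refine ⟨fun _ => hlevel, fun hpos hlt => ?_⟩
  have hcond : (P : Measure X) ≪ (Q : Measure X)
      ∧ Integrable (llr (P : Measure X) Q) (P : Measure X) := by
    by_contra h
    simp [klDiv, h] at hlt
  obtain ⟨hPQ, h_int⟩ := hcond
  set D := ∫ x, llr (P : Measure X) Q x ∂(P : Measure X) with hD
  have hkl : klDiv (P : Measure X) (Q : Measure X) = ENNReal.ofReal D := if_pos ⟨hPQ, h_int⟩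
  rw [hkl] at hpos ⊢
  have hD0 : 0 < D := ENNReal.ofReal_pos.1 hpos
  rw [EReal.coe_ennreal_ofReal, max_eq_left hD0.le]
  have hm : Tendsto (fun n : ℕ => (m n : ℝ)) atTop atTop := by
    refine tendsto_atTop_mono' _ ?_ tendsto_natCast_atTop_atTop
    filter_upwards [eventually_gt_atTop 0, hmn.eventually_ge_atTop 1] with n hn h1
    rwa [one_le_div (by exact_mod_cast hn)] at h1
  have hm0 : ∀ᶠ n in atTop, 0 < m n := by
    filter_upwards [hm.eventually_gt_atTop 0] with n hn
    exact_mod_cast hn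
  have hγ0 : Tendsto (fun n => γ (m n) n) atTop (𝓝 0) := by
    simp_rw [hγ]
    have h1 := (hm.const_div_atTop K).sqrt
    have h2 := ((tendsto_natCast_atTop_atTop (R := ℝ)).const_div_atTop K).sqrt
    have h3 := (h1.add h2).mul_const (2 + Real.sqrt (2 * Real.log (2 / α)))
    simpa using h3
  apply le_antisymm
  · refine EReal.le_of_forall_lt_iff_le.1 fun z hz => ?_
    have hz' : 0 < (z - D) / 2 := by
      have := EReal.coe_lt_coe_iff.1 hz
      linarith
    refine liminf_le_of_frequently_le' (Eventually.frequently ?_)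
    filter_upwards [eventually_gt_atTop 0, eventually_exp_le_typeII k hkm P Q hPQ h_int hα1 hα0 m hm0
      γ hlevel hz'] with n hn h
    refine expRate_le hn ?_
    rwa [← hD, show D + 2 * ((z - D) / 2) = z by ring] at h
  · refine EReal.ge_of_forall_gt_iff_ge.1 fun z hz => ?_
    have hz' : 0 < (D - z) / 6 := by
      have := EReal.coe_lt_coe_iff.1 hz
      linarith
    refine le_liminf_of_le (by isBoundedDefault) ?_
    filter_upwards [eventually_gt_atTop 0, eventually_typeII_le_exp k hkm hk_symm hk_psd K hK hk_bdd
      h_tri h_metrize P Q hPQ h_int m hmn hm γ hγ0 hz'] with n hn h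
    refine le_expRate hn ?_
    rwa [← hD, show D - 6 * ((D - z) / 6) = z by ring] at h
end
end
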